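/- arXiv:2311.04853 — 5 statements merged into one kernel-verified Lean document; each statement's English description precedes it below -/
import Mathlib

section
/- Let μ be a positive Borel measure on ℝ orthonormalizing (p_n). Suppose there are an open subset U of ℝ, a sequence (ρ_n)_{n≥0} of positive reals tending to infinity, a strictly increasing sequence (n_k)_{k∈ℕ} of natural numbers and a function h : U → ℝ that is not identically zero, such that (1/ρ_{n_k})·K_{n_k}(x, x) → h(x) as k → ∞, locally uniformly in x ∈ U. Then μ is determinate, and for every continuous f : ℝ → ℝ with compact support contained in U, (1/ρ_{n_k}) ∫ f dν_{n_k} → ∫ f·h dμ as k → ∞. -/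
open MeasureTheory Filter Topology

/-- A positive Borel measure `μ` on `ℝ` orthonormalizes the family `p` if all
polynomials are `μ`-integrable and `∫ pₙ pₘ dμ = δₙₘ`. -/
def Orthonormalizes (p : ℕ → ℝ → ℝ) (μ : Measure ℝ) : Prop :=
  (∀ n : ℕ, Integrable (fun x : ℝ => x ^ n) μ) ∧
  (∀ n m : ℕ, Integrable (fun x : ℝ => p n x * p m x) μ) ∧
  (∀ n m : ℕ, (∫ x, p n x * p m x ∂μ) = if n = m then 1 else 0)

/-- Three-term recurrence with spectral parameter `z`. -/
def JRec (a b : ℕ → ℝ) (z : ℂ) (u : ℕ → ℂ) : Prop :=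
  ∀ n, (a n : ℂ) * u n + (b (n + 1) : ℂ) * u (n + 1) + (a (n + 1) : ℂ) * u (n + 2)
    = z * u (n + 1)

/-- The orthonormal polynomials at a complex point. -/
noncomputable def pz (a b : ℕ → ℝ) (z : ℂ) : ℕ → ℂ
  | 0 => 1
  | 1 => (z - b 0) / a 0
  | (n + 2) => ((z - b (n + 1)) * pz a b z (n + 1) - a n * pz a b z n) / a (n + 1)

lemma pz_rec (a b : ℕ → ℝ) (ha : ∀ n, 0 < a n) (z : ℂ) : JRec a b z (pz a b z) := by
  intro n
  have h1 : (a (n + 1) : ℂ) ≠ 0 := by exact_mod_cast (ha (n + 1)).ne'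
  have : pz a b z (n + 2)
    = ((z - b (n + 1)) * pz a b z (n + 1) - a n * pz a b z n) / a (n + 1) := by
    rw [pz]
  rw [this]
  field_simp
  ring

lemma gronwall_aux (a b : ℕ → ℝ) (z x : ℂ) (u v w : ℕ → ℂ)
    (hu : JRec a b z u) (hv : JRec a b z v) (hw : JRec a b x w)
    (hW0 : (a 0 : ℂ) * (u 0 * v 1 - u 1 * v 0) = 1)
    (Cu Cv : ℝ) (hCu : ∀ n, ∑ i ∈ Finset.range n, ‖u i‖ ^ 2 ≤ Cu)
    (hCv : ∀ n, ∑ i ∈ Finset.range n, ‖v i‖ ^ 2 ≤ Cv) :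
    ∃ C, ∀ n, ∑ i ∈ Finset.range n, ‖w i‖ ^ 2 ≤ C := by
  have hW : ∀ n, (a n : ℂ) * (u n * v (n + 1) - u (n + 1) * v n) = 1 := by
    intro n
    induction n with
    | zero => exact hW0
    | succ n ih =>
      linear_combination ih + u (n + 1) * hv n - v (n + 1) * hu n
  set A : ℕ → ℂ := fun n => (a n : ℂ) * (w n * v (n + 1) - w (n + 1) * v n) with hA
  set B : ℕ → ℂ := fun n => (a n : ℂ) * (u n * w (n + 1) - u (n + 1) * w n) with hB
  have e0 : ∀ n, w n = A n * u n + B n * v n := by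
    intro n; simp only [hA, hB]; linear_combination (-w n) * hW n
  have e1 : ∀ n, w (n + 1) = A n * u (n + 1) + B n * v (n + 1) := by
    intro n; simp only [hA, hB]; linear_combination (-w (n + 1)) * hW n
  have eA : ∀ n, A (n + 1) = A n + (z - x) * w (n + 1) * v (n + 1) := by
    intro n; simp only [hA]
    linear_combination w (n + 1) * hv n - v (n + 1) * hw n
  have eB : ∀ n, B (n + 1) = B n + (x - z) * w (n + 1) * u (n + 1) := by
    intro n; simp only [hB]
    linear_combination u (n + 1) * hw n - w (n + 1) * hu n
  clear_value A B
  set c := ‖z - x‖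
  set m : ℕ → ℝ := fun n => ‖u n‖ + ‖v n‖ with hm
  have hm0 : ∀ n, 0 ≤ m n := fun n => by positivity
  set T : ℕ → ℝ := fun n => ‖A n‖ + ‖B n‖ with hT
  have hT0 : ∀ n, 0 ≤ T n := fun n => by positivity
  have hw1 : ∀ n, ‖w (n + 1)‖ ≤ T n * m (n + 1) := by
    intro n
    rw [e1 n]
    refine (norm_add_le _ _).trans ?_
    rw [norm_mul, norm_mul]
    simp only [hT, hm]
    nlinarith [norm_nonneg (A n), norm_nonneg (B n), norm_nonneg (u (n+1)), norm_nonneg (v (n+1)),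
      mul_nonneg (norm_nonneg (A n)) (norm_nonneg (v (n+1))),
      mul_nonneg (norm_nonneg (B n)) (norm_nonneg (u (n+1)))]
  have hw0 : ∀ n, ‖w n‖ ≤ T n * m n := by
    intro n
    rw [e0 n]
    refine (norm_add_le _ _).trans ?_
    rw [norm_mul, norm_mul]
    simp only [hT, hm]
    nlinarith [norm_nonneg (A n), norm_nonneg (B n), norm_nonneg (u (n)), norm_nonneg (v (n)),
      mul_nonneg (norm_nonneg (A n)) (norm_nonneg (v (n))),
      mul_nonneg (norm_nonneg (B n)) (norm_nonneg (u (n)))]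
  have hTs : ∀ n, T (n + 1) ≤ T n * Real.exp (c * m (n + 1) ^ 2) := by
    intro n
    have h1 : ‖A (n + 1)‖ ≤ ‖A n‖ + c * ‖w (n + 1)‖ * ‖v (n + 1)‖ := by
      rw [eA n]; refine (norm_add_le _ _).trans ?_
      rw [norm_mul, norm_mul]
    have h2 : ‖B (n + 1)‖ ≤ ‖B n‖ + c * ‖w (n + 1)‖ * ‖u (n + 1)‖ := by
      rw [eB n]; refine (norm_add_le _ _).trans ?_
      rw [norm_mul, norm_mul, norm_sub_rev x z]
    have h3 : T (n + 1) ≤ T n + c * ‖w (n + 1)‖ * m (n + 1) := by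
      simp only [hT, hm]; linarith
    have h4 : c * ‖w (n + 1)‖ * m (n + 1) ≤ c * (T n * m (n + 1)) * m (n + 1) := by
      have := hw1 n
      have := hm0 (n + 1)
      have : 0 ≤ c := norm_nonneg _
      gcongr
    have h5 := Real.add_one_le_exp (c * m (n + 1) ^ 2)
    have h6 := mul_le_mul_of_nonneg_left h5 (hT0 n)
    nlinarith
  have hTb : ∀ n, T n ≤ T 0 * Real.exp (c * ∑ i ∈ Finset.range (n + 1), m i ^ 2) := by
    intro n
    induction n with
    | zero =>
      have : 1 ≤ Real.exp (c * ∑ i ∈ Finset.range (0 + 1), m i ^ 2) :=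
        Real.one_le_exp (mul_nonneg (norm_nonneg _) (Finset.sum_nonneg fun i _ => sq_nonneg _))
      nlinarith [hT0 0]
    | succ n ih =>
      rw [Finset.sum_range_succ, mul_add, Real.exp_add, ← mul_assoc]
      exact (hTs n).trans (mul_le_mul_of_nonneg_right ih (Real.exp_pos _).le)
  have hms : ∀ n, ∑ i ∈ Finset.range n, m i ^ 2 ≤ 2 * (Cu + Cv) := by
    intro n
    have : ∑ i ∈ Finset.range n, m i ^ 2
        ≤ ∑ i ∈ Finset.range n, (2 * (‖u i‖ ^ 2) + 2 * ‖v i‖ ^ 2) := by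
      refine Finset.sum_le_sum fun i _ => ?_
      simp only [hm]
      nlinarith [sq_nonneg (‖u i‖ - ‖v i‖)]
    rw [Finset.sum_add_distrib, ← Finset.mul_sum, ← Finset.mul_sum] at this
    linarith [hCu n, hCv n]
  set M := T 0 * Real.exp (c * (2 * (Cu + Cv))) with hM
  have hTM : ∀ n, T n ≤ M := by
    intro n
    refine (hTb n).trans ?_
    refine mul_le_mul_of_nonneg_left (Real.exp_le_exp.2 ?_) (hT0 0)
    exact mul_le_mul_of_nonneg_left (hms _) (norm_nonneg _)
  refine ⟨M ^ 2 * (2 * (Cu + Cv)), fun n => ?_⟩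
  refine le_trans ?_ (mul_le_mul_of_nonneg_left (hms n) (sq_nonneg M))
  rw [Finset.mul_sum]
  refine Finset.sum_le_sum fun i _ => ?_
  rw [← mul_pow]
  refine pow_le_pow_left₀ (norm_nonneg _) ((hw0 i).trans ?_) 2
  exact mul_le_mul_of_nonneg_right (hTM i) (hm0 i)

lemma christoffel_darboux (a b : ℕ → ℝ) (ha : ∀ n, 0 < a n)
    (p : ℕ → ℝ → ℝ)
    (hp0 : ∀ x : ℝ, p 0 x = 1)
    (hp1 : ∀ x : ℝ, p 1 x = (x - b 0) / a 0)
    (hprec : ∀ n : ℕ, ∀ x : ℝ,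
      a n * p n x + b (n + 1) * p (n + 1) x + a (n + 1) * p (n + 2) x = x * p (n + 1) x)
    (n : ℕ) (x y : ℝ) :
    (x - y) * ∑ j ∈ Finset.range (n + 1), p j x * p j y
      = a n * (p (n + 1) x * p n y - p n x * p (n + 1) y) := by
  induction n with
  | zero =>
    have := (ha 0).ne'
    simp [hp0, hp1]; field_simp; ring
  | succ n ih =>
    rw [Finset.sum_range_succ, mul_add, ih]
    linear_combination p (n + 1) x * hprec n y - p (n + 1) y * hprec n x

/-- The family `p 0, ..., p N` is orthonormal with respect to `σ`. -/
def OUpTo (p : ℕ → ℝ → ℝ) (σ : Measure ℝ) (N : ℕ) : Prop :=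
  ∀ n ≤ N, ∀ m ≤ N, Integrable (fun x : ℝ => p n x * p m x) σ ∧
    (∫ x, p n x * p m x ∂σ) = if n = m then 1 else 0

/-- Christoffel-Darboux kernel on the diagonal. -/
noncomputable def KK (p : ℕ → ℝ → ℝ) (n : ℕ) (x : ℝ) : ℝ :=
  ∑ j ∈ Finset.range (n + 1), (p j x) ^ 2

/-- Gauss quadrature measure. -/
noncomputable def gauss (p : ℕ → ℝ → ℝ) (Z : Finset ℝ) (n : ℕ) : Measure ℝ :=
  ∑ y ∈ Z, ENNReal.ofReal ((KK p n y)⁻¹) • Measure.dirac y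

lemma KK_pos (p : ℕ → ℝ → ℝ) (hp0 : ∀ x : ℝ, p 0 x = 1) (n : ℕ) (x : ℝ) : 0 < KK p n x := by
  unfold KK
  rw [Finset.sum_range_succ']
  have : 0 ≤ ∑ k ∈ Finset.range n, p (k + 1) x ^ 2 := Finset.sum_nonneg fun i _ => sq_nonneg _
  rw [hp0]; linarith

lemma gauss_integrable (p : ℕ → ℝ → ℝ) (Z : Finset ℝ) (n : ℕ) (g : ℝ → ℝ) :
    Integrable g (gauss p Z n) := by
  unfold gauss
  rw [integrable_finsetSum_measure]
  intro y _
  refine Integrable.smul_measure ?_ ENNReal.ofReal_ne_top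
  exact integrable_dirac (by simp)

lemma gauss_integral (p : ℕ → ℝ → ℝ) (hp0 : ∀ x : ℝ, p 0 x = 1) (Z : Finset ℝ) (n : ℕ)
    (g : ℝ → ℝ) :
    ∫ x, g x ∂(gauss p Z n) = ∑ y ∈ Z, (KK p n y)⁻¹ * g y := by
  unfold gauss
  rw [integral_finsetSum_measure]
  · refine Finset.sum_congr rfl fun y _ => ?_
    rw [integral_smul_measure, integral_dirac,
      ENNReal.toReal_ofReal (inv_nonneg.2 (KK_pos p hp0 n y).le), smul_eq_mul]
  · intro y _
    refine Integrable.smul_measure ?_ ENNReal.ofReal_ne_top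
    exact integrable_dirac (by simp)

lemma gauss_ortho (a b : ℕ → ℝ) (ha : ∀ n, 0 < a n)
    (p : ℕ → ℝ → ℝ)
    (hp0 : ∀ x : ℝ, p 0 x = 1)
    (hp1 : ∀ x : ℝ, p 1 x = (x - b 0) / a 0)
    (hprec : ∀ n : ℕ, ∀ x : ℝ,
      a n * p n x + b (n + 1) * p (n + 1) x + a (n + 1) * p (n + 2) x = x * p (n + 1) x)
    (N : ℕ) (Z : Finset ℝ) (hZcard : Z.card = N + 1) (hZ : ∀ y ∈ Z, p (N + 1) y = 0) :
    OUpTo p (gauss p Z N) N := by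
  intro n hn m hm
  refine ⟨gauss_integrable _ _ _ _, ?_⟩
  rw [gauss_integral p hp0]
  obtain ⟨e⟩ : Nonempty (Fin (N + 1) ≃ Z) :=
    ⟨(Fintype.equivFinOfCardEq (by simpa using hZcard)).symm⟩
  let V : Matrix (Fin (N + 1)) (Fin (N + 1)) ℝ := Matrix.of fun i j => p i (e j)
  let W : Matrix (Fin (N + 1)) (Fin (N + 1)) ℝ := Matrix.of fun j i => (KK p N (e j))⁻¹ * p i (e j)
  have h1 : W * V = 1 := by
    ext i j
    simp only [Matrix.mul_apply, W, V, Matrix.one_apply, Matrix.of_apply, mul_assoc]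
    rw [← Finset.mul_sum, Fin.sum_univ_eq_sum_range
      (fun k => p k (e i : ℝ) * p k (e j : ℝ)) (N + 1)]
    split_ifs with hij
    · subst hij
      have := (KK_pos p hp0 N (e i)).ne'
      rw [inv_mul_eq_one₀ this]
      simp [KK, sq]
    · have hcd := christoffel_darboux a b ha p hp0 hp1 hprec N (e i) (e j)
      rw [hZ _ (e i).2, hZ _ (e j).2] at hcd
      simp only [zero_mul, mul_zero, sub_zero, mul_eq_zero] at hcd
      rcases hcd with h | h
      · exact absurd (e.injective (Subtype.ext (sub_eq_zero.1 h))) hij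
      · rw [h, mul_zero]
  have h2 : V * W = 1 := mul_eq_one_comm.1 h1
  have h3 := congrFun (congrFun h2 ⟨n, by omega⟩) ⟨m, by omega⟩
  simp only [Matrix.mul_apply, W, V, Matrix.one_apply, Matrix.of_apply, Fin.mk.injEq] at h3
  rw [← h3, ← Finset.sum_coe_sort, ← e.sum_comp]
  refine Finset.sum_congr rfl fun i _ => ?_
  ring

lemma OUpTo.mono {p : ℕ → ℝ → ℝ} {σ : Measure ℝ} {N M : ℕ} (h : OUpTo p σ N) (hM : M ≤ N) :
    OUpTo p σ M := fun n hn m hm => h n (hn.trans hM) m (hm.trans hM)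

lemma OUpTo.prob {p : ℕ → ℝ → ℝ} {σ : Measure ℝ} {N : ℕ} (h : OUpTo p σ N)
    (hp0 : ∀ x : ℝ, p 0 x = 1) : IsProbabilityMeasure σ := by
  have h1 := h 0 (Nat.zero_le _) 0 (Nat.zero_le _)
  simp only [hp0, mul_one, if_true] at h1
  have : IsFiniteMeasure σ := by
    have := h1.1
    rw [integrable_const_iff] at this
    simpa using this
  have h2 := h1.2
  rw [integral_const, smul_eq_mul, mul_one] at h2
  exact ⟨by rwa [Measure.real, ENNReal.toReal_eq_one_iff] at h2⟩

lemma OUpTo.int {p : ℕ → ℝ → ℝ} {σ : Measure ℝ} {N : ℕ} (h : OUpTo p σ N)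
    (hp0 : ∀ x : ℝ, p 0 x = 1) {n : ℕ} (hn : n ≤ N) : Integrable (p n) σ := by
  have h1 := (h n hn 0 (Nat.zero_le _)).1
  simpa [hp0] using h1

lemma bessel_real {p : ℕ → ℝ → ℝ} {σ : Measure ℝ} {N : ℕ} (h : OUpTo p σ N)
    (hp0 : ∀ x : ℝ, p 0 x = 1) (g : ℝ → ℝ) (hg : Continuous g) (C : ℝ) (hC : ∀ x, |g x| ≤ C) :
    ∑ n ∈ Finset.range (N + 1), (∫ x, p n x * g x ∂σ) ^ 2 ≤ C ^ 2 := by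
  have := h.prob hp0
  set c : ℕ → ℝ := fun n => ∫ x, p n x * g x ∂σ with hc
  have hI : ∀ n ∈ Finset.range (N + 1), Integrable (fun x => c n * (p n x * g x)) σ := by
    intro n hn
    refine Integrable.const_mul ?_ _
    exact (h.int hp0 (Finset.mem_range_succ_iff.1 hn)).mul_bdd (c := C) hg.aestronglyMeasurable
      (Eventually.of_forall hC)
  have hI2 : ∀ n ∈ Finset.range (N + 1), ∀ m ∈ Finset.range (N + 1),
      Integrable (fun x => c n * c m * (p n x * p m x)) σ := by
    intro n hn m hm
    exact (h n (Finset.mem_range_succ_iff.1 hn) m (Finset.mem_range_succ_iff.1 hm)).1.const_mul _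
  have hgg : Integrable (fun x => g x ^ 2) σ := by
    refine Integrable.of_bound (hg.pow 2).aestronglyMeasurable (C ^ 2) (Eventually.of_forall ?_)
    intro x
    rw [Real.norm_eq_abs, abs_pow]
    exact pow_le_pow_left₀ (abs_nonneg _) (hC x) 2
  have hgg2 : ∫ x, g x ^ 2 ∂σ ≤ C ^ 2 := by
    have : ∫ x, g x ^ 2 ∂σ ≤ ∫ x, C ^ 2 ∂σ := by
      refine integral_mono hgg (integrable_const _) fun x => ?_
      simp only
      rw [← sq_abs]
      exact pow_le_pow_left₀ (abs_nonneg _) (hC x) 2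
    simpa using this
  have e1 : ∫ x, ∑ n ∈ Finset.range (N + 1), c n * (p n x * g x) ∂σ
      = ∑ n ∈ Finset.range (N + 1), c n ^ 2 := by
    rw [integral_finsetSum _ hI]
    refine Finset.sum_congr rfl fun n _ => ?_
    rw [integral_const_mul, sq]
  have e2 : ∫ x, ∑ n ∈ Finset.range (N + 1), ∑ m ∈ Finset.range (N + 1),
      c n * c m * (p n x * p m x) ∂σ = ∑ n ∈ Finset.range (N + 1), c n ^ 2 := by
    rw [integral_finsetSum _ (fun n hn => integrable_finsetSum _ (hI2 n hn))]
    refine Finset.sum_congr rfl fun n hn => ?_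
    rw [integral_finsetSum _ (hI2 n hn)]
    rw [Finset.sum_eq_single n]
    · rw [integral_const_mul, (h n (Finset.mem_range_succ_iff.1 hn) n
        (Finset.mem_range_succ_iff.1 hn)).2]
      simp [sq]
    · intro m hm hmn
      rw [integral_const_mul, (h n (Finset.mem_range_succ_iff.1 hn) m
        (Finset.mem_range_succ_iff.1 hm)).2, if_neg hmn.symm, mul_zero]
    · exact fun h' => absurd hn h'
  have e3 : ∫ x, 2 * ∑ n ∈ Finset.range (N + 1), c n * (p n x * g x) ∂σ
      ≤ ∫ x, (g x ^ 2 + ∑ n ∈ Finset.range (N + 1), ∑ m ∈ Finset.range (N + 1),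
      c n * c m * (p n x * p m x)) ∂σ := by
    refine integral_mono ((integrable_finsetSum _ hI).const_mul _)
      (hgg.add (integrable_finsetSum _ (fun n hn => integrable_finsetSum _ (hI2 n hn)))) ?_
    intro x
    have s1 : ∑ n ∈ Finset.range (N + 1), c n * (p n x * g x)
        = (∑ n ∈ Finset.range (N + 1), c n * p n x) * g x := by
      rw [Finset.sum_mul]; exact Finset.sum_congr rfl fun _ _ => by ring
    have s2 : ∑ n ∈ Finset.range (N + 1), ∑ m ∈ Finset.range (N + 1),
        c n * c m * (p n x * p m x) = (∑ n ∈ Finset.range (N + 1), c n * p n x) ^ 2 := by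
      rw [sq, Finset.sum_mul_sum]
      exact Finset.sum_congr rfl fun _ _ => Finset.sum_congr rfl fun _ _ => by ring
    simp only [s1, s2]
    nlinarith [sq_nonneg (g x - ∑ n ∈ Finset.range (N + 1), c n * p n x)]
  rw [integral_const_mul, integral_add hgg
    (integrable_finsetSum _ (fun n hn => integrable_finsetSum _ (hI2 n hn))), e1, e2] at e3
  linarith

/-- Coefficients of the resolvent function. -/
noncomputable def RR (p : ℕ → ℝ → ℝ) (σ : Measure ℝ) (z : ℂ) (n : ℕ) : ℂ :=
  ∫ x, (p n x : ℂ) * ((x : ℂ) - z)⁻¹ ∂σ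

lemma sub_ne {z : ℂ} (hz : 0 < z.im) (x : ℝ) : (x : ℂ) - z ≠ 0 := by
  intro h
  have := congrArg Complex.im h
  simp at this
  exact hz.ne' this

lemma norm_res {z : ℂ} (hz : 0 < z.im) (x : ℝ) : ‖((x : ℂ) - z)⁻¹‖ ≤ z.im⁻¹ := by
  rw [norm_inv]
  refine inv_anti₀ hz ?_
  have := Complex.abs_im_le_norm ((x : ℂ) - z)
  simp only [Complex.sub_im, Complex.ofReal_im, zero_sub, abs_neg] at this
  exact (le_abs_self _).trans this

lemma cont_res {z : ℂ} (hz : 0 < z.im) : Continuous fun x : ℝ => ((x : ℂ) - z)⁻¹ :=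
  (Complex.continuous_ofReal.sub continuous_const).inv₀ (sub_ne hz)

lemma RR_int {p : ℕ → ℝ → ℝ} {σ : Measure ℝ} {N : ℕ} (h : OUpTo p σ N)
    (hp0 : ∀ x : ℝ, p 0 x = 1) {z : ℂ} (hz : 0 < z.im) {n : ℕ} (hn : n ≤ N) :
    Integrable (fun x : ℝ => (p n x : ℂ) * ((x : ℂ) - z)⁻¹) σ :=
  (h.int hp0 hn).ofReal.mul_bdd (c := z.im⁻¹) (cont_res hz).aestronglyMeasurable
      (Eventually.of_forall (norm_res hz))

lemma RR_bessel {p : ℕ → ℝ → ℝ} {σ : Measure ℝ} {N : ℕ} (h : OUpTo p σ N)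
    (hp0 : ∀ x : ℝ, p 0 x = 1) {z : ℂ} (hz : 0 < z.im) :
    ∑ n ∈ Finset.range (N + 1), ‖RR p σ z n‖ ^ 2 ≤ 2 * (z.im⁻¹) ^ 2 := by
  have h1 := bessel_real h hp0 (fun x => (((x : ℂ) - z)⁻¹).re)
    (Complex.continuous_re.comp (cont_res hz)) z.im⁻¹
    (fun x => (Complex.abs_re_le_norm _).trans (norm_res hz x))
  have h2 := bessel_real h hp0 (fun x => (((x : ℂ) - z)⁻¹).im)
    (Complex.continuous_im.comp (cont_res hz)) z.im⁻¹
    (fun x => (Complex.abs_im_le_norm _).trans (norm_res hz x))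
  have : ∑ n ∈ Finset.range (N + 1), ‖RR p σ z n‖ ^ 2 =
      ∑ n ∈ Finset.range (N + 1), (∫ x, p n x * (((x : ℂ) - z)⁻¹).re ∂σ) ^ 2
      + ∑ n ∈ Finset.range (N + 1), (∫ x, p n x * (((x : ℂ) - z)⁻¹).im ∂σ) ^ 2 := by
    rw [← Finset.sum_add_distrib]
    refine Finset.sum_congr rfl fun n hn => ?_
    have hi := RR_int h hp0 hz (Finset.mem_range_succ_iff.1 hn)
    have r1 : (RR p σ z n).re = ∫ x, p n x * (((x : ℂ) - z)⁻¹).re ∂σ := by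
      have := integral_re hi
      simp only [RCLike.re_eq_complex_re, Complex.re_ofReal_mul] at this
      exact this.symm
    have r2 : (RR p σ z n).im = ∫ x, p n x * (((x : ℂ) - z)⁻¹).im ∂σ := by
      have := integral_im hi
      simp only [RCLike.im_eq_complex_im, Complex.im_ofReal_mul] at this
      exact this.symm
    rw [← r1, ← r2, Complex.sq_norm, Complex.normSq_apply]; ring
  rw [this]; linarith

lemma RR_key (p : ℕ → ℝ → ℝ) (hp0 : ∀ x : ℝ, p 0 x = 1)
    {σ : Measure ℝ} {N : ℕ} (h : OUpTo p σ N) {z : ℂ} (hz : 0 < z.im)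
    {n : ℕ} (hn : n ≤ N) :
    ∫ x, (x : ℂ) * ((p n x : ℂ) * ((x : ℂ) - z)⁻¹) ∂σ
      = (if n = 0 then 1 else 0) + z * RR p σ z n := by
  have e : ∀ x : ℝ, (x : ℂ) * ((p n x : ℂ) * ((x : ℂ) - z)⁻¹)
      = (p n x : ℂ) + z * ((p n x : ℂ) * ((x : ℂ) - z)⁻¹) := by
    intro x
    have := sub_ne hz x
    field_simp
    ring
  simp_rw [e]
  have ip : Integrable (fun x : ℝ => (p n x : ℂ)) σ := (h.int hp0 hn).ofReal
  rw [integral_add ip ((RR_int h hp0 hz hn).const_mul _), integral_const_mul]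
  have h2 := (h n hn 0 (Nat.zero_le _)).2
  simp only [hp0, mul_one] at h2
  rw [integral_complex_ofReal, h2]
  congr 1
  split_ifs <;> simp

lemma RR_zero (a b : ℕ → ℝ) (ha : ∀ n, 0 < a n) (p : ℕ → ℝ → ℝ) (hp0 : ∀ x : ℝ, p 0 x = 1)
    (hp1 : ∀ x : ℝ, p 1 x = (x - b 0) / a 0)
    {σ : Measure ℝ} {N : ℕ} (h : OUpTo p σ N) {z : ℂ} (hz : 0 < z.im)
    (hN : 1 ≤ N) : (a 0 : ℂ) * RR p σ z 1 + b 0 * RR p σ z 0 = 1 + z * RR p σ z 0 := by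
  have hk := RR_key p hp0 h hz (Nat.zero_le N)
  rw [if_pos rfl] at hk
  rw [← hk, RR, RR, ← integral_const_mul, ← integral_const_mul, ← integral_add
    ((RR_int h hp0 hz hN).const_mul _) ((RR_int h hp0 hz (Nat.zero_le N)).const_mul _)]
  congr 1
  ext x
  have : (a 0 : ℂ) ≠ 0 := by exact_mod_cast (ha 0).ne'
  rw [hp1, hp0]
  push_cast
  field_simp
  ring

lemma RR_succ (a b : ℕ → ℝ) (p : ℕ → ℝ → ℝ) (hp0 : ∀ x : ℝ, p 0 x = 1)
    (hprec : ∀ n : ℕ, ∀ x : ℝ,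
      a n * p n x + b (n + 1) * p (n + 1) x + a (n + 1) * p (n + 2) x = x * p (n + 1) x)
    {σ : Measure ℝ} {N : ℕ} (h : OUpTo p σ N) {z : ℂ} (hz : 0 < z.im)
    {n : ℕ} (hN : n + 2 ≤ N) :
    (a n : ℂ) * RR p σ z n + b (n + 1) * RR p σ z (n + 1) + a (n + 1) * RR p σ z (n + 2)
      = z * RR p σ z (n + 1) := by
  have hk := RR_key p hp0 h hz (n := n + 1) (by omega)
  rw [if_neg (by omega), zero_add] at hk
  have i0 := (RR_int h hp0 hz (n := n) (by omega)).const_mul (a n : ℂ)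
  have i1 := (RR_int h hp0 hz (n := n + 1) (by omega)).const_mul (b (n + 1) : ℂ)
  have i2 := (RR_int h hp0 hz (n := n + 2) (by omega)).const_mul (a (n + 1) : ℂ)
  have i01 : Integrable (fun x : ℝ => (a n : ℂ) * ((p n x : ℂ) * ((x : ℂ) - z)⁻¹)
      + (b (n + 1) : ℂ) * ((p (n + 1) x : ℂ) * ((x : ℂ) - z)⁻¹)) σ := i0.add i1
  rw [← hk, RR, RR, RR, ← integral_const_mul, ← integral_const_mul, ← integral_const_mul,
    ← integral_add i0 i1, ← integral_add i01 i2]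
  congr 1
  ext x
  have := congrArg (fun t : ℝ => (t : ℂ)) (hprec n x)
  push_cast at this
  linear_combination ((x : ℂ) - z)⁻¹ * this

lemma RR_diff (a b : ℕ → ℝ) (ha : ∀ n, 0 < a n) (p : ℕ → ℝ → ℝ) (hp0 : ∀ x : ℝ, p 0 x = 1)
    (hp1 : ∀ x : ℝ, p 1 x = (x - b 0) / a 0)
    (hprec : ∀ n : ℕ, ∀ x : ℝ,
      a n * p n x + b (n + 1) * p (n + 1) x + a (n + 1) * p (n + 2) x = x * p (n + 1) x)
    {σ μ : Measure ℝ} {N : ℕ} (h : OUpTo p σ N) (h' : OUpTo p μ N)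
    {z : ℂ} (hz : 0 < z.im) :
    ∀ n ≤ N, RR p σ z n - RR p μ z n = (RR p σ z 0 - RR p μ z 0) * pz a b z n := by
  intro n
  induction n using Nat.strong_induction_on with
  | _ n ih =>
    intro hn
    match n, ih, hn with
    | 0, _, _ => simp [pz]
    | 1, _, hn =>
      have h1 := RR_zero a b ha p hp0 hp1 h hz hn
      have h2 := RR_zero a b ha p hp0 hp1 h' hz hn
      have h0 : (a 0 : ℂ) ≠ 0 := by exact_mod_cast (ha 0).ne'
      have : pz a b z 1 = (z - b 0) / a 0 := by rw [pz]
      rw [this]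
      field_simp
      linear_combination h1 - h2
    | (n + 2), ih, hn =>
      have h1 := RR_succ a b p hp0 hprec h hz hn
      have h2 := RR_succ a b p hp0 hprec h' hz hn
      have h0 : (a (n + 1) : ℂ) ≠ 0 := by exact_mod_cast (ha (n + 1)).ne'
      have i0 := ih n (by omega) (by omega)
      have i1 := ih (n + 1) (by omega) (by omega)
      have h3 := pz_rec a b ha z n
      refine mul_left_cancel₀ h0 ?_
      linear_combination h1 - h2 - (RR p σ z 0 - RR p μ z 0) * h3 + (z - b (n + 1)) * i1 - a n * i0

lemma pz_unbdd (a b : ℕ → ℝ) (ha : ∀ n, 0 < a n) (p : ℕ → ℝ → ℝ) (hp0 : ∀ x : ℝ, p 0 x = 1)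
    (hp1 : ∀ x : ℝ, p 1 x = (x - b 0) / a 0)
    (hprec : ∀ n : ℕ, ∀ x : ℝ,
      a n * p n x + b (n + 1) * p (n + 1) x + a (n + 1) * p (n + 2) x = x * p (n + 1) x)
    {μ : Measure ℝ} (hμ : ∀ N, OUpTo p μ N) {z : ℂ} (hz : 0 < z.im) (x : ℝ)
    (hx : ¬ ∃ C, ∀ n, ∑ i ∈ Finset.range n, p i x ^ 2 ≤ C) :
    ¬ ∃ C, ∀ n, ∑ i ∈ Finset.range n, ‖pz a b z i‖ ^ 2 ≤ C := by
  rintro ⟨C, hC⟩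
  apply hx
  have hr : JRec a b z (RR p μ z) := fun n => RR_succ a b p hp0 hprec (hμ (n + 2)) hz le_rfl
  have hw : JRec a b x (fun n => (p n x : ℂ)) := by
    intro n
    have := hprec n x
    simp only
    exact_mod_cast this
  have h0 : (a 0 : ℂ) ≠ 0 := by exact_mod_cast (ha 0).ne'
  have h1 : pz a b z 1 = (z - b 0) / a 0 := by rw [pz]
  have h2 : pz a b z 0 = 1 := by rw [pz]
  obtain ⟨D, hD⟩ := gronwall_aux a b z x (pz a b z) (RR p μ z) (fun n => (p n x : ℂ))
    (pz_rec a b ha z) hr hw (by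
      rw [h1, h2]
      have := RR_zero a b ha p hp0 hp1 (hμ 1) hz le_rfl
      field_simp
      linear_combination this) C (2 * (z.im⁻¹) ^ 2) hC (by
      intro n
      refine le_trans ?_ (RR_bessel (hμ n) hp0 hz)
      exact Finset.sum_le_sum_of_subset_of_nonneg (Finset.range_mono (Nat.le_succ n))
        fun _ _ _ => by positivity)
  refine ⟨D, fun n => ?_⟩
  simpa using hD n

lemma RR_tendsto (a b : ℕ → ℝ) (ha : ∀ n, 0 < a n) (p : ℕ → ℝ → ℝ) (hp0 : ∀ x : ℝ, p 0 x = 1)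
    (hp1 : ∀ x : ℝ, p 1 x = (x - b 0) / a 0)
    (hprec : ∀ n : ℕ, ∀ x : ℝ,
      a n * p n x + b (n + 1) * p (n + 1) x + a (n + 1) * p (n + 2) x = x * p (n + 1) x)
    {μ : Measure ℝ} (hμ : ∀ N, OUpTo p μ N) {z : ℂ} (hz : 0 < z.im) (x : ℝ)
    (hx : ¬ ∃ C, ∀ n, ∑ i ∈ Finset.range n, p i x ^ 2 ≤ C)
    (σ : ℕ → Measure ℝ) (N : ℕ → ℕ) (hN : Tendsto N atTop atTop)
    (hσ : ∀ k, OUpTo p (σ k) (N k)) :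
    Tendsto (fun k => RR p (σ k) z 0) atTop (𝓝 (RR p μ z 0)) := by
  have hu := pz_unbdd a b ha p hp0 hp1 hprec hμ hz x hx
  rw [Metric.tendsto_atTop]
  intro ε hε
  push Not at hu
  obtain ⟨n, hn⟩ := hu (8 * (z.im⁻¹) ^ 2 / ε ^ 2)
  obtain ⟨k0, hk0⟩ := (tendsto_atTop.1 hN n).exists_forall_of_atTop
  refine ⟨k0, fun k hk => ?_⟩
  have hnk := hk0 k hk
  rw [dist_eq_norm]
  by_contra! hcon
  have hd := RR_diff a b ha p hp0 hp1 hprec (hσ k) (hμ (N k)) hz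
  have b1 := RR_bessel (hσ k) hp0 hz
  have b2 := RR_bessel (hμ (N k)) hp0 hz
  have h1 : ∑ i ∈ Finset.range (N k + 1), ‖RR p (σ k) z i - RR p μ z i‖ ^ 2
      ≤ 8 * (z.im⁻¹) ^ 2 := by
    have : ∑ i ∈ Finset.range (N k + 1), ‖RR p (σ k) z i - RR p μ z i‖ ^ 2
        ≤ ∑ i ∈ Finset.range (N k + 1), (2 * ‖RR p (σ k) z i‖ ^ 2 + 2 * ‖RR p μ z i‖ ^ 2) := by
      refine Finset.sum_le_sum fun i _ => ?_
      have := norm_sub_le (RR p (σ k) z i) (RR p μ z i)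
      nlinarith [norm_nonneg (RR p (σ k) z i - RR p μ z i),
        sq_nonneg (‖RR p (σ k) z i‖ - ‖RR p μ z i‖)]
    rw [Finset.sum_add_distrib, ← Finset.mul_sum, ← Finset.mul_sum] at this
    linarith
  have h2 : ∑ i ∈ Finset.range n, ε ^ 2 * ‖pz a b z i‖ ^ 2
      ≤ ∑ i ∈ Finset.range (N k + 1), ‖RR p (σ k) z i - RR p μ z i‖ ^ 2 := by
    refine le_trans (Finset.sum_le_sum_of_subset_of_nonneg (Finset.range_mono
      (show n ≤ N k + 1 by omega)) fun _ _ _ => by positivity) ?_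
    refine Finset.sum_le_sum fun i hi => ?_
    rw [hd i (Finset.mem_range_succ_iff.1 hi), norm_mul, mul_pow]
    gcongr
  rw [← Finset.mul_sum] at h2
  rw [div_lt_iff₀ (by positivity)] at hn
  linarith

lemma poisson_unif (f : ℝ → ℝ) (hf : Continuous f) (hc : HasCompactSupport f) {ε : ℝ}
    (hε : 0 < ε) :
    ∃ y : ℝ, 0 < y ∧ ∀ x, |(∫ t, f (x + y * t) * (1 + t ^ 2)⁻¹) - Real.pi * f x| ≤ ε := by
  obtain ⟨M, hM⟩ := hf.bounded_above_of_compact_support hc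
  have huc := hc.uniformContinuous_of_continuous hf
  have hint : ∀ y x : ℝ, Integrable (fun t : ℝ => f (x + y * t) * (1 + t ^ 2)⁻¹) := by
    intro y x
    refine integrable_inv_one_add_sq.bdd_mul (c := M) ?_ (Eventually.of_forall fun t => hM _)
    exact (hf.comp (by fun_prop)).aestronglyMeasurable
  have key : Tendsto (fun q : ℝ × ℝ => ∫ t, (f (q.2 + q.1 * t) - f q.2) * (1 + t ^ 2)⁻¹)
      (𝓝[>] (0 : ℝ) ×ˢ (⊤ : Filter ℝ)) (𝓝 (∫ t : ℝ, (0 : ℝ))) := by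
    refine tendsto_integral_filter_of_dominated_convergence
      (fun t : ℝ => 2 * M * (1 + t ^ 2)⁻¹) ?_ ?_ ?_ ?_
    · refine Eventually.of_forall fun q => ?_
      refine AEStronglyMeasurable.mul ?_ integrable_inv_one_add_sq.aestronglyMeasurable
      exact ((hf.comp (by fun_prop)).sub continuous_const).aestronglyMeasurable
    · refine Eventually.of_forall fun q => Eventually.of_forall fun t => ?_
      rw [norm_mul]
      have h1 : (0 : ℝ) ≤ (1 + t ^ 2)⁻¹ := by positivity
      rw [Real.norm_of_nonneg h1]
      refine mul_le_mul_of_nonneg_right ?_ h1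
      refine (norm_sub_le _ _).trans ?_
      linarith [hM (q.2 + q.1 * t), hM q.2]
    · exact integrable_inv_one_add_sq.const_mul _
    · refine Eventually.of_forall fun t => ?_
      rw [Metric.tendsto_nhds]
      intro δ hδ
      obtain ⟨η, hη, hu⟩ := Metric.uniformContinuous_iff.1 huc δ hδ
      have : Tendsto (fun y : ℝ => y * t) (𝓝[>] 0) (𝓝 0) := by
        have : Tendsto (fun y : ℝ => y * t) (𝓝 0) (𝓝 (0 * t)) :=
          tendsto_id.mul tendsto_const_nhds
        rw [zero_mul] at this
        exact this.mono_left nhdsWithin_le_nhds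
      have h2 : ∀ᶠ y in 𝓝[>] (0 : ℝ), |y * t| < η := by
        have := (Metric.tendsto_nhds.1 this) η hη
        simpa using this
      have h3 : ∀ᶠ q in (𝓝[>] (0 : ℝ) ×ˢ (⊤ : Filter ℝ)), |q.1 * t| < η :=
        tendsto_fst.eventually h2
      filter_upwards [h3] with q hq
      have h4 : |f (q.2 + q.1 * t) - f q.2| < δ := by
        have := @hu (q.2 + q.1 * t) q.2 (by rw [Real.dist_eq]; simpa using hq)
        rwa [Real.dist_eq] at this
      rw [Real.dist_eq, sub_zero, abs_mul]
      have h5 : |(1 + t ^ 2)⁻¹| ≤ 1 := by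
        rw [abs_of_nonneg (by positivity)]
        exact inv_le_one_of_one_le₀ (by nlinarith [sq_nonneg t])
      calc _ ≤ |f (q.2 + q.1 * t) - f q.2| * 1 := by gcongr
        _ < δ := by simpa using h4
  have h6 := (Metric.tendsto_nhds.1 key) ε hε
  rw [Filter.eventually_prod_iff] at h6
  obtain ⟨P, hP, Q, hQ, h7⟩ := h6
  obtain ⟨y, hy, hy0⟩ := (hP.and self_mem_nhdsWithin).exists
  refine ⟨y, hy0, fun x => ?_⟩
  have hQx : Q x := by
    rw [Filter.eventually_top] at hQ
    exact hQ x
  have h8 := h7 hy hQx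
  simp only [integral_zero, Real.dist_eq, sub_zero] at h8
  have h9 : ∫ t, (f (x + y * t) - f x) * (1 + t ^ 2)⁻¹
      = (∫ t, f (x + y * t) * (1 + t ^ 2)⁻¹) - Real.pi * f x := by
    simp_rw [sub_mul]
    rw [integral_sub (hint y x) (integrable_inv_one_add_sq.const_mul _), integral_const_mul,
      integral_univ_inv_one_add_sq, mul_comm (f x)]
  rw [h9] at h8
  exact h8.le

lemma poisson_cov (f : ℝ → ℝ) {y : ℝ} (hy : 0 < y) (x : ℝ) :
    ∫ t, f (x + y * t) * (1 + t ^ 2)⁻¹ = ∫ s, f s * (y / ((x - s) ^ 2 + y ^ 2)) := by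
  set G : ℝ → ℝ := fun s => f s * (y / ((x - s) ^ 2 + y ^ 2)) with hG
  have h1 := Measure.integral_comp_mul_left (fun s => G (x + s)) y
  rw [integral_add_left_eq_self G x, abs_of_pos (inv_pos.2 hy), smul_eq_mul] at h1
  have h2 : ∀ t, f (x + y * t) * (1 + t ^ 2)⁻¹ = y * G (x + y * t) := by
    intro t
    simp only [hG]
    have : (1 + t ^ 2) ≠ 0 := by positivity
    have h3 : (x - (x + y * t)) ^ 2 + y ^ 2 = y ^ 2 * (1 + t ^ 2) := by ring
    rw [h3]
    field_simp
  simp_rw [h2]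
  rw [integral_const_mul, h1]
  field_simp

lemma kernel_le {y : ℝ} (hy : 0 < y) (x s : ℝ) :
    |y / ((x - s) ^ 2 + y ^ 2)| ≤ y⁻¹ := by
  rw [abs_of_nonneg (by positivity), div_le_iff₀ (by positivity)]
  have : y⁻¹ * ((x - s) ^ 2 + y ^ 2) = y⁻¹ * (x - s) ^ 2 + y := by field_simp
  rw [this]
  have : 0 ≤ y⁻¹ * (x - s) ^ 2 := by positivity
  linarith

lemma RR_im {p : ℕ → ℝ → ℝ} {σ : Measure ℝ} {N : ℕ} (h : OUpTo p σ N)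
    (hp0 : ∀ x : ℝ, p 0 x = 1) (s : ℝ) {y : ℝ} (hy : 0 < y) :
    (RR p σ ⟨s, y⟩ 0).im = ∫ x, y / ((x - s) ^ 2 + y ^ 2) ∂σ := by
  have hz : 0 < (⟨s, y⟩ : ℂ).im := hy
  have := integral_im (RR_int h hp0 hz (Nat.zero_le N))
  simp only [RCLike.im_eq_complex_im, Complex.im_ofReal_mul] at this
  rw [RR, ← this]
  congr 1
  ext x
  rw [hp0, one_mul, Complex.inv_im, Complex.normSq_apply]
  simp only [Complex.sub_re, Complex.sub_im, Complex.ofReal_re, Complex.ofReal_im]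
  congr 1
  · ring
  · ring

lemma kernel_prod_int (σ : Measure ℝ) [IsFiniteMeasure σ] (f : ℝ → ℝ) (hf : Continuous f)
    (hc : HasCompactSupport f) {y : ℝ} (hy : 0 < y) :
    Integrable (Function.uncurry fun x s : ℝ => f s * (y / ((x - s) ^ 2 + y ^ 2)))
      (σ.prod volume) := by
  have h1 : Integrable (fun q : ℝ × ℝ => f q.2) (σ.prod volume) :=
    (hf.integrable_of_hasCompactSupport hc).comp_snd σ
  have hcont : Continuous fun q : ℝ × ℝ => y / ((q.1 - q.2) ^ 2 + y ^ 2) := by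
    refine continuous_const.div (by fun_prop) fun q => ?_
    positivity
  exact h1.mul_bdd (c := y⁻¹) hcont.aestronglyMeasurable
    (Eventually.of_forall fun q => kernel_le hy q.1 q.2)

lemma fubini {p : ℕ → ℝ → ℝ} {σ : Measure ℝ} {N : ℕ} (h : OUpTo p σ N)
    (hp0 : ∀ x : ℝ, p 0 x = 1) (f : ℝ → ℝ) (hf : Continuous f)
    (hc : HasCompactSupport f) {y : ℝ} (hy : 0 < y) :
    ∫ x, (∫ t, f (x + y * t) * (1 + t ^ 2)⁻¹) ∂σ = ∫ s, f s * (RR p σ ⟨s, y⟩ 0).im := by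
  have := h.prob hp0
  simp_rw [poisson_cov f hy, RR_im h hp0 _ hy]
  rw [integral_integral_swap (kernel_prod_int σ f hf hc hy)]
  simp_rw [integral_const_mul]

lemma approx {p : ℕ → ℝ → ℝ} {σ : Measure ℝ} {N : ℕ} (h : OUpTo p σ N)
    (hp0 : ∀ x : ℝ, p 0 x = 1) (f : ℝ → ℝ) (hf : Continuous f)
    (hc : HasCompactSupport f) {y : ℝ} (hy : 0 < y) {ε : ℝ}
    (hb : ∀ x, |(∫ t, f (x + y * t) * (1 + t ^ 2)⁻¹) - Real.pi * f x| ≤ ε) :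
    |(∫ s, f s * (RR p σ ⟨s, y⟩ 0).im) - Real.pi * ∫ x, f x ∂σ| ≤ ε := by
  have := h.prob hp0
  rw [← fubini h hp0 f hf hc hy, ← integral_const_mul, ← integral_sub]
  · have := norm_integral_le_of_norm_le_const (μ := σ)
      (f := fun x => (∫ t, f (x + y * t) * (1 + t ^ 2)⁻¹) - Real.pi * f x) (C := ε)
      (Eventually.of_forall hb)
    simpa using this
  · simp_rw [poisson_cov f hy]
    exact (kernel_prod_int σ f hf hc hy).integral_prod_left
  · obtain ⟨M, hM⟩ := hf.bounded_above_of_compact_support hc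
    exact (Integrable.of_bound hf.aestronglyMeasurable M (Eventually.of_forall hM)).const_mul _

lemma weak_conv {p : ℕ → ℝ → ℝ} (hp0 : ∀ x : ℝ, p 0 x = 1) {μ : Measure ℝ}
    (hμ : OUpTo p μ 0) (σ : ℕ → Measure ℝ) (hσ : ∀ k, OUpTo p (σ k) 0)
    (hR : ∀ z : ℂ, 0 < z.im → Tendsto (fun k => RR p (σ k) z 0) atTop (𝓝 (RR p μ z 0)))
    (f : ℝ → ℝ) (hf : Continuous f) (hc : HasCompactSupport f) :
    Tendsto (fun k => ∫ x, f x ∂(σ k)) atTop (𝓝 (∫ x, f x ∂μ)) := by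
  rw [Metric.tendsto_atTop]
  intro ε hε
  obtain ⟨y, hy, hb⟩ := poisson_unif f hf hc hε
  have hlim : Tendsto (fun k => ∫ s, f s * (RR p (σ k) ⟨s, y⟩ 0).im) atTop
      (𝓝 (∫ s, f s * (RR p μ ⟨s, y⟩ 0).im)) := by
    refine tendsto_integral_of_dominated_convergence (fun s => |f s| * y⁻¹) ?_ ?_ ?_ ?_
    · intro k
      have := (hσ k).prob hp0
      have := (kernel_prod_int (σ k) f hf hc hy).integral_prod_right.aestronglyMeasurable
      simp only [Function.uncurry] at this
      simp_rw [RR_im (hσ k) hp0 _ hy]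
      simpa only [integral_const_mul] using this
    · exact (hf.integrable_of_hasCompactSupport hc).abs.mul_const _
    · intro k
      refine Eventually.of_forall fun s => ?_
      have := (hσ k).prob hp0
      rw [norm_mul, Real.norm_eq_abs]
      refine mul_le_mul_of_nonneg_left ?_ (abs_nonneg _)
      rw [RR_im (hσ k) hp0 _ hy]
      have := norm_integral_le_of_norm_le_const (μ := σ k)
        (f := fun x => y / ((x - s) ^ 2 + y ^ 2)) (C := y⁻¹) (Eventually.of_forall fun x => kernel_le hy x s)
      simpa using this
    · refine Eventually.of_forall fun s => ?_
      refine tendsto_const_nhds.mul ?_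
      exact (Complex.continuous_im.tendsto _).comp (hR ⟨s, y⟩ hy)
  obtain ⟨k0, hk0⟩ := (Metric.tendsto_atTop.1 hlim) (Real.pi * ε - 2 * ε)
    (by nlinarith [Real.pi_gt_three])
  refine ⟨k0, fun k hk => ?_⟩
  have h1 := hk0 k hk
  have h2 := approx (hσ k) hp0 f hf hc hy hb
  have h3 := approx hμ hp0 f hf hc hy hb
  rw [Real.dist_eq] at h1 ⊢
  rw [abs_lt] at h1 ⊢
  rw [abs_le] at h2 h3
  have hpi := Real.pi_pos
  constructor
  · by_contra! hcon
    nlinarith [mul_le_mul_of_nonneg_left hcon hpi.le]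
  · by_contra! hcon
    nlinarith [mul_le_mul_of_nonneg_left hcon hpi.le]

/-- Lemma 1 of the paper.
If `(1/ρ_{n_k}) K_{n_k}(x,x) → h(x)` locally uniformly on an open set `U`, with `h` not
identically zero, then `μ` is determinate and
`(1/ρ_{n_k}) ∫ f dν_{n_k} → ∫ f·h dμ` for every `f ∈ C_c(U)`. -/
theorem stmt_2
    (a b : ℕ → ℝ) (ha : ∀ n, 0 < a n)
    (p : ℕ → ℝ → ℝ)
    (hp0 : ∀ x : ℝ, p 0 x = 1)
    (hp1 : ∀ x : ℝ, p 1 x = (x - b 0) / a 0)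
    (hprec : ∀ n : ℕ, ∀ x : ℝ,
      a n * p n x + b (n + 1) * p (n + 1) x + a (n + 1) * p (n + 2) x = x * p (n + 1) x)
    (Z : ℕ → Finset ℝ)
    (hZcard : ∀ n, (Z n).card = n + 1)
    (hZ : ∀ n, ∀ y : ℝ, y ∈ Z n ↔ p (n + 1) y = 0)
    (μ : Measure ℝ) (hμ : Orthonormalizes p μ)
    (U : Set ℝ) (hU : IsOpen U)
    (ρ : ℕ → ℝ) (hρpos : ∀ n, 0 < ρ n) (hρ : Tendsto ρ atTop atTop)
    (nk : ℕ → ℕ) (hnk : StrictMono nk)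
    (h : ℝ → ℝ) (hh : ∃ x ∈ U, h x ≠ 0)
    (hconv : TendstoLocallyUniformlyOn
      (fun k x => (ρ (nk k))⁻¹ * ∑ j ∈ Finset.range (nk k + 1), (p j x) ^ 2)
      h atTop U) :
    (∀ μ' : Measure ℝ, Orthonormalizes p μ' → μ' = μ) ∧
    ∀ f : ℝ → ℝ, Continuous f → HasCompactSupport f → tsupport f ⊆ U →
      Tendsto (fun k => (ρ (nk k))⁻¹ * ∑ y ∈ Z (nk k), f y) atTop
        (𝓝 (∫ x, f x * h x ∂μ)) := by
  have hO : ∀ μ' : Measure ℝ, Orthonormalizes p μ' → ∀ N, OUpTo p μ' N :=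
    fun μ' h' N n _ m _ => ⟨h'.2.1 n m, h'.2.2 n m⟩
  have hnkt : Tendsto nk atTop atTop := hnk.tendsto_atTop
  have hρt : Tendsto (fun k => (ρ (nk k))⁻¹) atTop (𝓝 0) :=
    (hρ.comp hnkt).inv_tendsto_atTop
  obtain ⟨x₀, hx₀U, hx₀⟩ := hh
  have hx : ¬ ∃ C, ∀ n, ∑ i ∈ Finset.range n, p i x₀ ^ 2 ≤ C := by
    rintro ⟨C, hC⟩
    have h1 := hconv.tendsto_at hx₀U
    have h2 : Tendsto (fun k => (ρ (nk k))⁻¹ *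
        ∑ j ∈ Finset.range (nk k + 1), (p j x₀) ^ 2) atTop (𝓝 0) := by
      have h3 : Tendsto (fun k => (ρ (nk k))⁻¹ * C) atTop (𝓝 0) := by
        simpa using hρt.mul_const C
      refine squeeze_zero (fun k => ?_) (fun k => ?_) h3
      · exact mul_nonneg (inv_nonneg.2 (hρpos _).le) (Finset.sum_nonneg fun _ _ => sq_nonneg _)
      · exact mul_le_mul_of_nonneg_left (hC _) (inv_nonneg.2 (hρpos _).le)
    exact hx₀ (tendsto_nhds_unique h1 h2)
  have hmain : ∀ (σ : ℕ → Measure ℝ) (N : ℕ → ℕ), Tendsto N atTop atTop →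
      (∀ k, OUpTo p (σ k) (N k)) → ∀ f : ℝ → ℝ, Continuous f → HasCompactSupport f →
      Tendsto (fun k => ∫ x, f x ∂(σ k)) atTop (𝓝 (∫ x, f x ∂μ)) := by
    intro σ N hN hσ f hf hc
    refine weak_conv hp0 (hO μ hμ 0) σ (fun k => (hσ k).mono (Nat.zero_le _)) ?_ f hf hc
    intro z hz
    exact RR_tendsto a b ha p hp0 hp1 hprec (hO μ hμ) hz x₀ hx σ N hN hσ
  have hprob : IsProbabilityMeasure μ := (hO μ hμ 0).prob hp0
  refine ⟨?_, ?_⟩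
  · intro μ' hμ'
    have hprob' : IsProbabilityMeasure μ' := (hO μ' hμ' 0).prob hp0
    refine Measure.ext_of_integral_eq_on_compactlySupported fun f => ?_
    have h1 := hmain (fun _ => μ') id tendsto_id (fun k => hO μ' hμ' k) f
      f.continuous f.hasCompactSupport
    exact tendsto_nhds_unique tendsto_const_nhds h1
  · intro f hf hc hfU
    have hpc : ∀ n, Continuous (p n) := by
      intro n
      induction n using Nat.strong_induction_on with
      | _ n ih =>
        match n, ih with
        | 0, _ => rw [show p 0 = fun _ => 1 from funext hp0]; exact continuous_const
        | 1, _ =>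
          rw [show p 1 = fun x => (x - b 0) / a 0 from funext hp1]
          fun_prop
        | (n + 2), ih =>
          have e : p (n + 2) = fun x => (x * p (n + 1) x - b (n + 1) * p (n + 1) x
              - a n * p n x) / a (n + 1) := by
            ext x
            rw [eq_div_iff (ha (n + 1)).ne']
            linear_combination hprec n x
          have := ih n (by omega)
          have := ih (n + 1) (by omega)
          rw [e]
          fun_prop
    have hhc : ContinuousOn h U := by
      refine hconv.continuousOn (Eventually.frequently (Eventually.of_forall fun k => ?_))
      exact (continuous_const.mul (continuous_finsetSum _ fun i _ => (hpc i).pow 2)).continuousOn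
    have hfh : Continuous fun x => f x * h x := by
      rw [continuous_iff_continuousAt]
      intro x
      by_cases hxs : x ∈ tsupport f
      · exact hf.continuousAt.mul (hhc.continuousAt (hU.mem_nhds (hfU hxs)))
      · have : (fun x => f x * h x) =ᶠ[𝓝 x] fun _ => 0 := by
          have h1 := notMem_tsupport_iff_eventuallyEq.1 hxs
          filter_upwards [h1] with t ht
          rw [ht]; simp
        exact continuousAt_const.congr this.symm
    have hfhc : HasCompactSupport fun x => f x * h x := hc.mul_right
    have hG : ∀ k, OUpTo p (gauss p (Z (nk k)) (nk k)) (nk k) := fun k =>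
      gauss_ortho a b ha p hp0 hp1 hprec (nk k) _ (hZcard _) (fun y hy => (hZ _ y).1 hy)
    have h1 := hmain _ nk hnkt hG _ hfh hfhc
    obtain ⟨M, hM⟩ := hf.bounded_above_of_compact_support hc
    have hM0 : 0 ≤ M := (norm_nonneg _).trans (hM 0)
    have h2 : Tendsto (fun k => (ρ (nk k))⁻¹ * ∑ y ∈ Z (nk k), f y
        - ∫ x, f x * h x ∂(gauss p (Z (nk k)) (nk k))) atTop (𝓝 0) := by
      have hu := (tendstoLocallyUniformlyOn_iff_forall_isCompact hU).1 hconv _ hfU hc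
      rw [Metric.tendstoUniformlyOn_iff] at hu
      rw [Metric.tendsto_nhds]
      intro ε hε
      filter_upwards [hu (ε / (M + 1)) (by positivity)] with k hk
      have := (hG k).prob hp0
      have e1 : (ρ (nk k))⁻¹ * ∑ y ∈ Z (nk k), f y
          = ∫ x, f x * ((ρ (nk k))⁻¹ * KK p (nk k) x) ∂(gauss p (Z (nk k)) (nk k)) := by
        rw [gauss_integral p hp0, Finset.mul_sum]
        refine Finset.sum_congr rfl fun y _ => ?_
        have := (KK_pos p hp0 (nk k) y).ne'
        field_simp
      rw [e1, ← integral_sub (gauss_integrable _ _ _ _) (gauss_integrable _ _ _ _), dist_zero_right]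
      have hb : ∀ x, ‖f x * ((ρ (nk k))⁻¹ * KK p (nk k) x) - f x * h x‖ ≤ M * (ε / (M + 1)) := by
        intro x
        rw [← mul_sub, norm_mul]
        by_cases hxs : x ∈ tsupport f
        · have h3 := hk x hxs
          rw [dist_comm, dist_eq_norm] at h3
          exact mul_le_mul (hM x) h3.le (norm_nonneg _) hM0
        · rw [image_eq_zero_of_notMem_tsupport hxs, norm_zero, zero_mul]
          positivity
      have h4 := norm_integral_le_of_norm_le_const (μ := gauss p (Z (nk k)) (nk k))
        (Eventually.of_forall hb)
      rw [probReal_univ, mul_one] at h4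
      refine h4.trans_lt ?_
      rw [← mul_div_assoc, div_lt_iff₀ (by positivity)]
      nlinarith
    simpa using h2.add h1
end

section
/- Let μ be a determinate positive Borel measure on ℝ orthonormalizing (p_n). Let (a, b) ⊂ ℝ be an open interval such that supp(μ) ∩ [c, d] is finite for every compact interval [c, d] ⊂ (a, b). Then for every sequence (ρ_n) of positive reals tending to infinity and every continuous f : ℝ → ℝ with compact support contained in (a, b), one has (1/ρ_n) ∫ f dν_n → 0 as n → ∞. -/
open MeasureTheory Filter Topology

/-- The (topological) support of a measure on `ℝ`: points all of whose neighbourhoods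
have nonzero measure. -/
def measSupport (μ : Measure ℝ) : Set ℝ :=
  {x : ℝ | ∀ ε > 0, μ (Set.Ioo (x - ε) (x + ε)) ≠ 0}

open Polynomial in
/-- The orthonormal family is given by polynomials of exact degree. -/
lemma exists_poly_family (a b : ℕ → ℝ) (ha : ∀ n, 0 < a n)
    (p : ℕ → ℝ → ℝ)
    (hp0 : ∀ x : ℝ, p 0 x = 1)
    (hp1 : ∀ x : ℝ, p 1 x = (x - b 0) / a 0)
    (hprec : ∀ n : ℕ, ∀ x : ℝ,
      a n * p n x + b (n + 1) * p (n + 1) x + a (n + 1) * p (n + 2) x = x * p (n + 1) x)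
    (n : ℕ) : ∃ P : ℝ[X], (∀ x, P.eval x = p n x) ∧ P.natDegree ≤ n ∧ P.coeff n ≠ 0 := by
  induction n using Nat.strong_induction_on with
  | _ n ih =>
    match n, ih with
    | 0, _ => exact ⟨1, by simp [hp0], by simp, by simp⟩
    | 1, _ =>
      refine ⟨C (a 0)⁻¹ * (X - C (b 0)), ?_, ?_, ?_⟩
      · intro x
        rw [hp1]
        simp
        ring
      · refine (natDegree_C_mul_le _ _).trans ?_
        simp
      · simp [coeff_C, (ha 0).ne']
    | m + 2, ih =>
      obtain ⟨P, hP, hPd, -⟩ := ih m (by omega)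
      obtain ⟨Q, hQ, hQd, hQc⟩ := ih (m + 1) (by omega)
      refine ⟨C (a (m + 1))⁻¹ * (X * Q - C (b (m + 1)) * Q - C (a m) * P), ?_, ?_, ?_⟩
      · intro x
        have h := hprec m x
        have h0 := (ha (m + 1)).ne'
        simp only [eval_mul, eval_C, eval_sub, eval_X, hP, hQ]
        field_simp
        linarith
      · refine (natDegree_C_mul_le _ _).trans ?_
        refine (natDegree_sub_le _ _).trans (max_le ?_ ?_)
        · refine (natDegree_sub_le _ _).trans (max_le ?_ ?_)
          · refine natDegree_mul_le.trans ?_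
            rw [natDegree_X]
            omega
          · exact (natDegree_C_mul_le _ _).trans (by omega)
        · exact (natDegree_C_mul_le _ _).trans (by omega)
      · have h1 : Q.coeff (m + 2) = 0 := coeff_eq_zero_of_natDegree_lt (by omega)
        have h2 : P.coeff (m + 2) = 0 := coeff_eq_zero_of_natDegree_lt (by omega)
        rw [coeff_C_mul, coeff_sub, coeff_sub, coeff_C_mul, coeff_C_mul, coeff_X_mul, h1, h2]
        simp only [mul_zero, sub_zero]
        exact mul_ne_zero (inv_ne_zero (ha _).ne') hQc

open Polynomial in
lemma integrable_poly (μ : Measure ℝ) (h : ∀ n : ℕ, Integrable (fun x : ℝ => x ^ n) μ)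
    (Q : ℝ[X]) : Integrable (fun x => Q.eval x) μ := by
  simp only [eval_eq_sum_range]
  exact integrable_finset_sum _ fun i _ => (h i).const_mul _

open Polynomial in
lemma orth_lower (p : ℕ → ℝ → ℝ) (μ : Measure ℝ) (hμ : Orthonormalizes p μ)
    (P : ℕ → ℝ[X]) (hP : ∀ n x, (P n).eval x = p n x) (hd : ∀ n, (P n).natDegree ≤ n)
    (hc : ∀ n, (P n).coeff n ≠ 0) (n k : ℕ) (hk : k ≤ n) :
    ∀ q : ℝ[X], q.degree < k → ∫ x, (P n).eval x * q.eval x ∂μ = 0 := by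
  induction k with
  | zero =>
    intro q hq
    have : q = 0 := by
      rw [← degree_eq_bot]
      simpa using hq
    simp [this]
  | succ k ih =>
    intro q hq
    set c := q.coeff k / (P k).coeff k with hcdef
    have hr : (q - C c * P k).degree < k := by
      rw [degree_lt_iff_coeff_zero]
      intro m hm
      rcases hm.eq_or_lt with rfl | hm
      · rw [coeff_sub, coeff_C_mul, hcdef, div_mul_cancel₀ _ (hc _), sub_self]
      · rw [coeff_sub, coeff_C_mul, coeff_eq_zero_of_natDegree_lt ((hd k).trans_lt hm),
          (degree_lt_iff_coeff_zero _ _).1 hq m (by omega)]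
        simp
    have h1 := ih (by omega) _ hr
    have hi1 : Integrable (fun x => (P n).eval x * (q - C c * P k).eval x) μ := by
      simpa using integrable_poly μ hμ.1 (P n * (q - C c * P k))
    have hi2 : Integrable (fun x => c * (p n x * p k x)) μ := (hμ.2.1 n k).const_mul _
    have : (fun x => (P n).eval x * q.eval x) =
        fun x => (P n).eval x * (q - C c * P k).eval x + c * (p n x * p k x) := by
      funext x
      simp only [eval_sub, eval_mul, eval_C, hP]
      ring
    rw [this, integral_add hi1 hi2, h1, integral_const_mul, hμ.2.2, if_neg (by omega)]
    simp

open Polynomial in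
lemma gap_pos (p : ℕ → ℝ → ℝ) (μ : Measure ℝ) (hμ : Orthonormalizes p μ)
    (P : ℕ → ℝ[X]) (hP : ∀ n x, (P n).eval x = p n x) (hd : ∀ n, (P n).natDegree ≤ n)
    (hc : ∀ n, (P n).coeff n ≠ 0) (n : ℕ) (y z : ℝ) (hyz : y < z)
    (hy : p n y = 0) (hz : p n z = 0) : μ (Set.Ioo y z) ≠ 0 := by
  intro h0
  have hPne : P n ≠ 0 := by
    intro h
    apply hc n
    simp [h]
  obtain ⟨q1, hq1⟩ := dvd_iff_isRoot.2 (show (P n).IsRoot y by rw [IsRoot, hP, hy])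
  have hz1 : q1.IsRoot z := by
    have h := hP n z
    rw [hz, hq1] at h
    simp only [eval_mul, eval_sub, eval_X, eval_C] at h
    rcases mul_eq_zero.1 h with h | h
    · linarith
    · exact h
  obtain ⟨q, hq⟩ := dvd_iff_isRoot.2 hz1
  have hq1ne : q1 ≠ 0 := by
    rintro rfl
    simp at hq1
    exact hPne hq1
  have hqne : q ≠ 0 := by
    rintro rfl
    simp at hq
    exact hq1ne hq
  have hdeg : q.degree < n := by
    have e1 : (P n).natDegree = 1 + q1.natDegree := by
      rw [hq1, natDegree_mul (X_sub_C_ne_zero y) hq1ne, natDegree_X_sub_C]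
    have e2 : q1.natDegree = 1 + q.natDegree := by
      rw [hq, natDegree_mul (X_sub_C_ne_zero z) hqne, natDegree_X_sub_C]
    have := hd n
    rw [degree_eq_natDegree hqne]
    exact_mod_cast (by omega : q.natDegree < n)
  have hev : ∀ x, p n x = (x - y) * ((x - z) * q.eval x) := by
    intro x
    rw [← hP, hq1, hq]
    simp
  have hint := orth_lower p μ hμ P hP hd hc n n le_rfl q hdeg
  have hI : Integrable (fun x => (P n).eval x * q.eval x) μ := by
    simpa using integrable_poly μ hμ.1 (P n * q)
  have hae : ∀ᵐ x ∂μ, x ∉ Set.Ioo y z := measure_eq_zero_iff_ae_notMem.1 h0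
  have hnn : 0 ≤ᵐ[μ] fun x => (P n).eval x * q.eval x := by
    filter_upwards [hae] with x hx
    have e : (P n).eval x * q.eval x = ((x - y) * (x - z)) * (q.eval x) ^ 2 := by
      rw [hP, hev]
      ring
    simp only [Pi.zero_apply]
    rw [e]
    refine mul_nonneg ?_ (sq_nonneg _)
    rcases le_or_gt x y with h | h
    · exact mul_nonneg_of_nonpos_of_nonpos (by linarith) (by linarith)
    · have : z ≤ x := by
        by_contra h'
        exact hx ⟨h, not_le.1 h'⟩
      exact mul_nonneg (by linarith) (by linarith)
  have hz0 := (integral_eq_zero_iff_of_nonneg_ae hnn hI).1 hint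
  have hpz : (fun x => p n x * p n x) =ᵐ[μ] fun _ => (0 : ℝ) := by
    filter_upwards [hz0] with x hx
    simp only [Pi.zero_apply, hP] at hx
    rcases mul_eq_zero.1 hx with h | h
    · simp [h]
    · simp [hev, h]
  have h1 := hμ.2.2 n n
  rw [integral_congr_ae hpz] at h1
  simp at h1

lemma exists_supp (μ : Measure ℝ) (y z : ℝ) (h : μ (Set.Ioo y z) ≠ 0) :
    ∃ x ∈ measSupport μ, y < x ∧ x < z := by
  by_contra hcon
  push Not at hcon
  apply h
  refine measure_null_of_locally_null _ fun x hx => ?_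
  have hx' : x ∉ measSupport μ := fun hm => absurd hx.2 (not_lt.2 (hcon x hm hx.1))
  simp only [measSupport, Set.mem_setOf_eq, not_forall, not_not] at hx'
  obtain ⟨ε, hε, h0⟩ := hx'
  exact ⟨_, mem_nhdsWithin_of_mem_nhds (Ioo_mem_nhds (by linarith) (by linarith)), h0⟩

/-- Proposition 12 of the paper, determinate case.
If `supp(μ) ∩ [c,d]` is finite for every compact `[c,d] ⊂ (s,t)`, then
`(1/ρ_n) ∫ f dν_n → 0` for any `ρ_n → ∞` and any `f ∈ C_c((s,t))`. -/
theorem stmt_3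
    (a b : ℕ → ℝ) (ha : ∀ n, 0 < a n)
    (p : ℕ → ℝ → ℝ)
    (hp0 : ∀ x : ℝ, p 0 x = 1)
    (hp1 : ∀ x : ℝ, p 1 x = (x - b 0) / a 0)
    (hprec : ∀ n : ℕ, ∀ x : ℝ,
      a n * p n x + b (n + 1) * p (n + 1) x + a (n + 1) * p (n + 2) x = x * p (n + 1) x)
    (Z : ℕ → Finset ℝ)
    (hZcard : ∀ n, (Z n).card = n + 1)
    (hZ : ∀ n, ∀ y : ℝ, y ∈ Z n ↔ p (n + 1) y = 0)
    (μ : Measure ℝ) (hμ : Orthonormalizes p μ)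
    (hdet : ∀ μ' : Measure ℝ, Orthonormalizes p μ' → μ' = μ)
    (s t : ℝ)
    (hsupp : ∀ c d : ℝ, Set.Icc c d ⊆ Set.Ioo s t →
      (measSupport μ ∩ Set.Icc c d).Finite) :
    ∀ ρ : ℕ → ℝ, (∀ n, 0 < ρ n) → Tendsto ρ atTop atTop →
      ∀ f : ℝ → ℝ, Continuous f → HasCompactSupport f → tsupport f ⊆ Set.Ioo s t →
        Tendsto (fun n => (ρ n)⁻¹ * ∑ y ∈ Z n, f y) atTop (𝓝 0) := by
  intro ρ hρ hρt f hf hfc hfs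
  choose P hP hd hc using exists_poly_family a b ha p hp0 hp1 hprec
  have key : ∃ c d : ℝ, tsupport f ⊆ Set.Icc c d ∧ Set.Icc c d ⊆ Set.Ioo s t := by
    rcases (tsupport f).eq_empty_or_nonempty with he | hne
    · exact ⟨1, 0, by simp [he], by simp⟩
    · have hk : IsCompact (tsupport f) := hfc
      refine ⟨sInf (tsupport f), sSup (tsupport f), fun x hx =>
        ⟨csInf_le hk.bddBelow hx, le_csSup hk.bddAbove hx⟩, ?_⟩
      exact Set.Icc_subset_Ioo (hfs (hk.sInf_mem hne)).1 (hfs (hk.sSup_mem hne)).2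
  obtain ⟨c, d, hcd, hst⟩ := key
  have hfin := hsupp c d hst
  set N := hfin.toFinset.card with hN
  obtain ⟨M, hM⟩ := hf.bounded_above_of_compact_support hfc
  have hM0 : 0 ≤ M := (norm_nonneg _).trans (hM 0)
  have hcount : ∀ n, ((Z n).filter (fun y => y ∈ Set.Icc c d)).card ≤ N + 1 := by
    intro n
    refine Finset.card_le_of_interleaved ?_
    intro x hx y hy hxy _
    rw [Finset.mem_filter] at hx hy
    obtain ⟨w, hw, h1, h2⟩ := exists_supp μ x y
      (gap_pos p μ hμ P hP hd hc (n + 1) x y hxy ((hZ n x).1 hx.1) ((hZ n y).1 hy.1))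
    exact ⟨w, by
      rw [Set.Finite.mem_toFinset]
      exact ⟨hw, hx.2.1.trans h1.le, h2.le.trans hy.2.2⟩, h1, h2⟩
  have hsum : ∀ n, ‖∑ y ∈ Z n, f y‖ ≤ (N + 1 : ℝ) * M := by
    intro n
    have e : ∑ y ∈ Z n, f y = ∑ y ∈ (Z n).filter (fun y => y ∈ Set.Icc c d), f y := by
      symm
      refine Finset.sum_filter_of_ne ?_
      intro y _ hy
      exact hcd (subset_tsupport f hy)
    rw [e]
    refine (norm_sum_le_of_le _ (fun y _ => hM y)).trans ?_
    rw [Finset.sum_const, nsmul_eq_mul]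
    refine mul_le_mul_of_nonneg_right ?_ hM0
    exact_mod_cast hcount n
  refine squeeze_zero_norm (a := fun n => (ρ n)⁻¹ * ((N + 1 : ℝ) * M)) ?_ ?_
  · intro n
    rw [norm_mul, Real.norm_of_nonneg (inv_nonneg.2 (hρ n).le)]
    exact mul_le_mul_of_nonneg_left (hsum n) (inv_nonneg.2 (hρ n).le)
  · simpa using (tendsto_inv_atTop_zero.comp hρt).mul_const ((N + 1 : ℝ) * M)
end

section
/- Let μ be a determinate positive Borel measure on ℝ orthonormalizing (p_n), let (ρ_n)_{n≥0} be a sequence of positive reals tending to infinity, and let η_n be the finite measure with density K_n(x, x) with respect to μ (so η_n(ℝ) = n + 1). Then: (i) C[(1/ρ_n)·ν_n](z) − C[(1/ρ_n)·η_n](z) → 0 as n → ∞, locally uniformly in z ∈ ℂ∖ℝ; and (ii) for every integer L ≥ 0, C[(1/ρ_n)·η_{n+L}](z) − C[(1/ρ_n)·η_n](z) → 0 as n → ∞, locally uniformly in z ∈ ℂ∖ℝ. -/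
open MeasureTheory Filter Topology

/-- The Cauchy transform of a measure on `ℝ`: `C[ω](z) = ∫ 1/(x - z) dω(x)`. -/
noncomputable def cauchyTransform (ω : Measure ℝ) (z : ℂ) : ℂ :=
  ∫ x, ((x : ℂ) - z)⁻¹ ∂ω

/-- The zero counting measure `ν_n`: sum of Dirac measures at the zeros of `p_{n+1}`. -/
noncomputable def zeroCountingMeasure (Z : ℕ → Finset ℝ) (n : ℕ) : Measure ℝ :=
  ∑ y ∈ Z n, Measure.dirac y

/-- The measure `η_n` with density `K_n(x,x) = ∑_{k≤n} p_k(x)²` with respect to `μ`. -/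
noncomputable def cdMeasure (p : ℕ → ℝ → ℝ) (μ : Measure ℝ) (n : ℕ) : Measure ℝ :=
  μ.withDensity (fun x => ENNReal.ofReal (∑ k ∈ Finset.range (n + 1), (p k x) ^ 2))

lemma abs_trace_rank_one {ι : Type*} [Fintype ι] (A : ι → ι → ℂ) (d g : ι → ℂ) (C : ℝ)
    (hC : 0 ≤ C) (hA : ∀ i j, A i j = d i * g j) (hs : ∀ i j, A i j = A j i)
    (hb : ∀ f : ι → ℂ, ‖∑ i, ∑ j, f i * f j * A i j‖ ≤ C * ∑ i, ‖f i‖ ^ 2) :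
    ‖∑ i, A i i‖ ≤ C := by
  by_cases hd : ∀ i, d i = 0
  · simp [hA, hd, hC]
  push Not at hd
  obtain ⟨i0, hi0⟩ := hd
  set κ := g i0 / d i0 with hκ
  have hg : ∀ j, g j = κ * d j := by
    intro j
    have h1 := hs i0 j
    rw [hA, hA] at h1
    rw [hκ]
    field_simp
    linear_combination h1
  set S : ℝ := ∑ i, ‖d i‖ ^ 2 with hS
  have hSpos : 0 < S :=
    Finset.sum_pos' (fun i _ => by positivity) ⟨i0, Finset.mem_univ _, by positivity⟩
  have hSc : (S : ℂ) = ∑ i, (starRingEnd ℂ) (d i) * d i := by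
    rw [hS]; push_cast
    refine Finset.sum_congr rfl fun i _ => ?_
    rw [mul_comm, Complex.mul_conj']
  have h2 := hb (fun i => (starRingEnd ℂ) (d i))
  have h3 : ∑ i, ∑ j, (starRingEnd ℂ) (d i) * (starRingEnd ℂ) (d j) * A i j
      = κ * S * S := by
    have : κ * S * S = κ * ((S : ℂ) * S) := by ring
    rw [this, hSc, Finset.sum_mul_sum, Finset.mul_sum]
    refine Finset.sum_congr rfl fun i _ => ?_
    rw [Finset.mul_sum]
    refine Finset.sum_congr rfl fun j _ => ?_
    rw [hA, hg]; ring
  rw [h3] at h2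
  simp only [RCLike.norm_conj, norm_mul, Complex.norm_real, Real.norm_eq_abs, abs_of_pos hSpos] at h2
  have h4 : ‖κ‖ * S ≤ C := le_of_mul_le_mul_right h2 hSpos
  refine le_trans ?_ h4
  have h5 : ∑ i, A i i = κ * ∑ i, d i ^ 2 := by
    rw [Finset.mul_sum]
    refine Finset.sum_congr rfl fun i _ => ?_
    rw [hA, hg]; ring
  rw [h5, norm_mul]
  gcongr
  refine (norm_sum_le _ _).trans_eq ?_
  simp [hS]

lemma sub_ne_zero_of_im {z : ℂ} (hz : z.im ≠ 0) (x : ℝ) : (x : ℂ) - z ≠ 0 := by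
  intro h
  apply hz
  have := congrArg Complex.im h
  simpa using this

lemma norm_resolvent_le {z : ℂ} (hz : z.im ≠ 0) (x : ℝ) : ‖((x : ℂ) - z)⁻¹‖ ≤ |z.im|⁻¹ := by
  rw [norm_inv]
  have h := Complex.abs_im_le_norm ((x : ℂ) - z)
  simp only [Complex.sub_im, Complex.ofReal_im, zero_sub, abs_neg] at h
  exact inv_anti₀ (abs_pos.2 hz) h

lemma resolvent_continuous {z : ℂ} (hz : z.im ≠ 0) :
    Continuous (fun x : ℝ => ((x : ℂ) - z)⁻¹) :=
  (Complex.continuous_ofReal.sub continuous_const).inv₀ (sub_ne_zero_of_im hz)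

lemma integrable_mul_resolvent {μ : Measure ℝ} {z : ℂ} (hz : z.im ≠ 0) {f : ℝ → ℝ}
    (hf : Integrable f μ) : Integrable (fun x => (f x : ℂ) * ((x : ℂ) - z)⁻¹) μ := by
  have h : Integrable (fun x => (f x : ℂ)) μ := hf.ofReal
  exact h.mul_bdd (c := |z.im|⁻¹) (resolvent_continuous hz).aestronglyMeasurable
    (Eventually.of_forall (norm_resolvent_le hz))

lemma core_bound {ι : Type*} [Fintype ι] [DecidableEq ι] (μ : Measure ℝ) (y c : ι → ℝ)
    (v : ι → ℝ → ℝ) (q : ℝ → ℝ) (h : ∀ i x, v i x * (x - y i) = c i * q x)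
    (hint : ∀ i j, Integrable (fun x => v i x * v j x) μ)
    (hort : ∀ i j, ∫ x, v i x * v j x ∂μ = if i = j then 1 else 0)
    {z : ℂ} (hz : z.im ≠ 0) :
    ‖∑ i, ((∫ x, ((v i x * v i x : ℝ) : ℂ) * ((x : ℂ) - z)⁻¹ ∂μ) - ((y i : ℂ) - z)⁻¹)‖
      ≤ 2 * |z.im|⁻¹ := by
  set M : ι → ι → ℂ := fun i j => ∫ x, ((v i x * v j x : ℝ) : ℂ) * ((x : ℂ) - z)⁻¹ ∂μ with hM
  have hMi : ∀ i j, Integrable (fun x => ((v i x * v j x : ℝ) : ℂ) * ((x : ℂ) - z)⁻¹) μ :=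
    fun i j => integrable_mul_resolvent hz (hint i j)
  have hortc : ∀ i j, ∫ x, ((v i x * v j x : ℝ) : ℂ) ∂μ = if i = j then 1 else 0 := by
    intro i j
    rw [integral_complex_ofReal, hort]
    split_ifs <;> simp
  have key := abs_trace_rank_one
    (fun i j => M i j - (if i = j then 1 else 0) * ((y i : ℂ) - z)⁻¹)
    (fun i => -((c i : ℂ) * ((y i : ℂ) - z)⁻¹))
    (fun j => ∫ x, ((q x * v j x : ℝ) : ℂ) * ((x : ℂ) - z)⁻¹ ∂μ) (2 * |z.im|⁻¹) (by positivity)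
    ?_ ?_ ?_
  · simpa [hM] using key
  · intro i j
    simp only [hM]
    have hi1 : Integrable (fun x => ((v i x * v j x : ℝ) : ℂ) * ((y i : ℂ) - z)⁻¹) μ :=
      (Integrable.ofReal (hint i j)).mul_const _
    rw [← hortc, ← integral_mul_const, ← integral_sub (hMi i j) hi1, ← integral_const_mul]
    congr 1
    funext x
    have h1 := sub_ne_zero_of_im hz x
    have h2 := sub_ne_zero_of_im hz (y i)
    have h3 : (v i x : ℂ) * (x - y i) = c i * q x := by exact_mod_cast h i x
    push_cast
    field_simp
    linear_combination (-(v j x : ℂ)) * h3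
  · intro i j
    by_cases hij : i = j
    · subst hij; rfl
    · simp only [hM, hij, Ne.symm hij, if_false, mul_comm (v i _), zero_mul]
  · intro f
    have e1 : ∑ i, ∑ j, f i * f j * (M i j - (if i = j then 1 else 0) * ((y i : ℂ) - z)⁻¹)
        = (∫ x, (∑ i, f i * v i x) ^ 2 * ((x : ℂ) - z)⁻¹ ∂μ)
          - ∑ i, f i ^ 2 * ((y i : ℂ) - z)⁻¹ := by
      simp only [mul_sub, Finset.sum_sub_distrib]
      congr 1
      · simp only [hM, ← integral_const_mul]
        have : ∀ i, ∑ j, ∫ x, f i * f j * (((v i x * v j x : ℝ) : ℂ) * ((x : ℂ) - z)⁻¹) ∂μ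
            = ∫ x, ∑ j, f i * f j * (((v i x * v j x : ℝ) : ℂ) * ((x : ℂ) - z)⁻¹) ∂μ := fun i =>
          (integral_finsetSum _ fun j _ => (hMi i j).const_mul _).symm
        simp only [this]
        rw [← integral_finsetSum _ fun i _ => integrable_finsetSum _ fun j _ =>
          (hMi i j).const_mul _]
        congr 1
        funext x
        rw [pow_two, Finset.sum_mul_sum, Finset.sum_mul]
        refine Finset.sum_congr rfl fun i _ => ?_
        rw [Finset.sum_mul]
        refine Finset.sum_congr rfl fun j _ => ?_
        push_cast; ring
      · refine Finset.sum_congr rfl fun i _ => ?_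
        simp [pow_two]
    rw [e1]
    have e3 : ∀ x, (((‖∑ i, f i * v i x‖ ^ 2 : ℝ)) : ℂ)
        = ∑ i, ∑ j, f i * (starRingEnd ℂ) (f j) * ((v i x * v j x : ℝ) : ℂ) := by
      intro x
      push_cast
      rw [← Complex.mul_conj', map_sum, Finset.sum_mul_sum]
      refine Finset.sum_congr rfl fun i _ => Finset.sum_congr rfl fun j _ => ?_
      simp only [map_mul, Complex.conj_ofReal]
      ring
    have hi2 : ∀ i j, Integrable
        (fun x => f i * (starRingEnd ℂ) (f j) * ((v i x * v j x : ℝ) : ℂ)) μ :=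
      fun i j => (Integrable.ofReal (hint i j)).const_mul _
    have e4c : Integrable (fun x => (((‖∑ i, f i * v i x‖ ^ 2 : ℝ)) : ℂ)) μ := by
      simp only [e3]
      exact integrable_finsetSum _ fun i _ => integrable_finsetSum _ fun j _ => hi2 i j
    have e4 : Integrable (fun x => ‖∑ i, f i * v i x‖ ^ 2) μ := by
      have h := e4c.re
      simp only [RCLike.re_to_complex, Complex.ofReal_re] at h
      exact h
    have e5 : ∫ x, ‖∑ i, f i * v i x‖ ^ 2 ∂μ = ∑ i, ‖f i‖ ^ 2 := by
      have : ((∫ x, ‖∑ i, f i * v i x‖ ^ 2 ∂μ : ℝ) : ℂ) = ((∑ i, ‖f i‖ ^ 2 : ℝ) : ℂ) := by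
        rw [← integral_complex_ofReal]
        simp only [e3]
        rw [integral_finsetSum _ fun i _ => integrable_finsetSum _ fun j _ => hi2 i j]
        rw [Complex.ofReal_sum]
        refine Finset.sum_congr rfl fun i _ => ?_
        rw [integral_finsetSum _ fun j _ => hi2 i j]
        simp only [integral_const_mul, hortc]
        simp [Complex.mul_conj']
      exact_mod_cast this
    have b1 : ‖∫ x, (∑ i, f i * v i x) ^ 2 * ((x : ℂ) - z)⁻¹ ∂μ‖ ≤ |z.im|⁻¹ * ∑ i, ‖f i‖ ^ 2 := by
      rw [← e5, ← integral_const_mul]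
      refine norm_integral_le_of_norm_le (e4.const_mul _) (Eventually.of_forall fun x => ?_)
      rw [norm_mul, norm_pow, mul_comm]
      gcongr
      exact norm_resolvent_le hz x
    have b2 : ‖∑ i, f i ^ 2 * ((y i : ℂ) - z)⁻¹‖ ≤ |z.im|⁻¹ * ∑ i, ‖f i‖ ^ 2 := by
      refine (norm_sum_le _ _).trans ?_
      rw [Finset.mul_sum]
      refine Finset.sum_le_sum fun i _ => ?_
      rw [norm_mul, norm_pow, mul_comm]
      gcongr
      exact norm_resolvent_le hz _
    calc _ ≤ _ := norm_sub_le _ _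
      _ ≤ _ := add_le_add b1 b2
      _ = _ := by ring

lemma tendsto_of_bound (ρ : ℕ → ℝ) (hρ : Tendsto ρ atTop atTop) (G H : ℕ → ℂ → ℂ) (C : ℝ)
    (hC : 0 ≤ C) (hb : ∀ n z, z.im ≠ 0 → ‖G n z - H n z‖ ≤ C * |z.im|⁻¹) :
    TendstoLocallyUniformlyOn
      (fun n z => ((ρ n : ℂ))⁻¹ * G n z - ((ρ n : ℂ))⁻¹ * H n z)
      (fun _ => 0) atTop {z : ℂ | z.im ≠ 0} := by
  rw [Metric.tendstoLocallyUniformlyOn_iff]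
  intro ε hε z0 hz0
  have hz0' : 0 < |z0.im| := abs_pos.2 hz0
  refine ⟨{z | |z0.im| / 2 < |z.im|}, ?_, ?_⟩
  · apply mem_nhdsWithin_of_mem_nhds
    exact (isOpen_lt continuous_const (Complex.continuous_im.abs)).mem_nhds
      (by simp only [Set.mem_ofPred_eq]; linarith)
  · filter_upwards [hρ.eventually_gt_atTop (C * (|z0.im| / 2)⁻¹ / ε), hρ.eventually_gt_atTop 0]
      with n hn hpos z hz
    replace hz : |z0.im| / 2 < |z.im| := hz
    have hzp : 0 < |z.im| := by linarith
    rw [dist_zero_left, ← mul_sub, norm_mul, norm_inv, Complex.norm_real, Real.norm_eq_abs,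
      abs_of_pos hpos]
    have h1 : ‖G n z - H n z‖ ≤ C * (|z0.im| / 2)⁻¹ := by
      refine (hb n z (abs_pos.1 hzp)).trans ?_
      gcongr
    rw [div_lt_iff₀ hε] at hn
    rw [inv_mul_lt_iff₀ hpos]
    linarith

lemma cd_formula (a b : ℕ → ℝ) (ha : ∀ n, 0 < a n)
    (p : ℕ → ℝ → ℝ)
    (hp0 : ∀ x : ℝ, p 0 x = 1)
    (hp1 : ∀ x : ℝ, p 1 x = (x - b 0) / a 0)
    (hprec : ∀ n : ℕ, ∀ x : ℝ,
      a n * p n x + b (n + 1) * p (n + 1) x + a (n + 1) * p (n + 2) x = x * p (n + 1) x)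
    (n : ℕ) (x y : ℝ) :
    (∑ k ∈ Finset.range (n + 1), p k x * p k y) * (x - y)
      = a n * (p (n + 1) x * p n y - p n x * p (n + 1) y) := by
  induction n with
  | zero =>
    have := (ha 0).ne'
    simp [hp0, hp1]
    field_simp
    ring
  | succ n ih =>
    rw [Finset.sum_range_succ, add_mul, ih]
    linear_combination (p (n+1) x) * hprec n y - (p (n+1) y) * hprec n x

lemma p_continuous (a b : ℕ → ℝ) (ha : ∀ n, 0 < a n)
    (p : ℕ → ℝ → ℝ)
    (hp0 : ∀ x : ℝ, p 0 x = 1)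
    (hp1 : ∀ x : ℝ, p 1 x = (x - b 0) / a 0)
    (hprec : ∀ n : ℕ, ∀ x : ℝ,
      a n * p n x + b (n + 1) * p (n + 1) x + a (n + 1) * p (n + 2) x = x * p (n + 1) x)
    (n : ℕ) : Continuous (p n) := by
  suffices h : Continuous (p n) ∧ Continuous (p (n + 1)) from h.1
  induction n with
  | zero =>
    rw [show p 0 = fun _ => 1 from funext hp0, show p (0 + 1) = _ from funext hp1]
    exact ⟨continuous_const, by fun_prop⟩
  | succ n ih =>
    refine ⟨ih.2, ?_⟩
    obtain ⟨h1, h2⟩ := ih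
    have : p (n + 1 + 1) = fun x =>
        (x * p (n + 1) x - a n * p n x - b (n + 1) * p (n + 1) x) / a (n + 1) := by
      funext x
      rw [eq_div_iff (ha (n + 1)).ne', ← hprec n x]
      ring
    rw [this]
    fun_prop

lemma cauchy_zero (Z : ℕ → Finset ℝ) (n : ℕ) {z : ℂ} (hz : z.im ≠ 0) :
    cauchyTransform (zeroCountingMeasure Z n) z = ∑ y : Z n, (((y : ℝ) : ℂ) - z)⁻¹ := by
  unfold cauchyTransform zeroCountingMeasure
  rw [integral_finsetSum_measure, Finset.sum_coe_sort (Z n) (fun y : ℝ => ((y : ℂ) - z)⁻¹)]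
  · simp
  · intro i _
    exact integrable_dirac (by simp)

lemma cauchy_cd (p : ℕ → ℝ → ℝ) (hc : ∀ n, Continuous (p n)) (μ : Measure ℝ) (n : ℕ) (z : ℂ) :
    cauchyTransform (cdMeasure p μ n) z =
      ∫ x, ((∑ k ∈ Finset.range (n + 1), (p k x) ^ 2 : ℝ) : ℂ) * ((x : ℂ) - z)⁻¹ ∂μ := by
  unfold cauchyTransform cdMeasure
  rw [integral_withDensity_eq_integral_toReal_smul]
  · congr 1
    funext x
    rw [ENNReal.toReal_ofReal (Finset.sum_nonneg fun _ _ => sq_nonneg _), Complex.real_smul]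
  · have : Continuous fun x => ∑ k ∈ Finset.range (n + 1), (p k x) ^ 2 := by fun_prop
    exact this.measurable.ennreal_ofReal
  · exact Eventually.of_forall fun x => ENNReal.ofReal_lt_top

lemma main_bound (a b : ℕ → ℝ) (ha : ∀ n, 0 < a n)
    (p : ℕ → ℝ → ℝ)
    (hp0 : ∀ x : ℝ, p 0 x = 1)
    (hp1 : ∀ x : ℝ, p 1 x = (x - b 0) / a 0)
    (hprec : ∀ n : ℕ, ∀ x : ℝ,
      a n * p n x + b (n + 1) * p (n + 1) x + a (n + 1) * p (n + 2) x = x * p (n + 1) x)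
    (Z : ℕ → Finset ℝ)
    (hZcard : ∀ n, (Z n).card = n + 1)
    (hZ : ∀ n, ∀ y : ℝ, y ∈ Z n ↔ p (n + 1) y = 0)
    (μ : Measure ℝ) (hμ : Orthonormalizes p μ) (n : ℕ) (z : ℂ) (hz : z.im ≠ 0) :
    ‖cauchyTransform (zeroCountingMeasure Z n) z - cauchyTransform (cdMeasure p μ n) z‖
      ≤ 2 * |z.im|⁻¹ := by
  classical
  obtain ⟨-, hint, hort⟩ := hμ
  have hc := p_continuous a b ha p hp0 hp1 hprec
  have hcd := cd_formula a b ha p hp0 hp1 hprec n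
  set K : ℝ → ℝ → ℝ := fun x y => ∑ k ∈ Finset.range (n + 1), p k x * p k y with hK
  have hKpos : ∀ x, 0 < K x x := by
    intro x
    refine Finset.sum_pos' (fun k _ => mul_self_nonneg _) ⟨0, by simp, by simp [hp0]⟩
  have hKz : ∀ y y' : Z n, y ≠ y' → K y y' = 0 := by
    intro y y' hne
    have h1 := hcd y y'
    rw [(hZ n y).1 y.2, (hZ n y').1 y'.2] at h1
    have h2 : (y : ℝ) - y' ≠ 0 := sub_ne_zero.2 fun h => hne (Subtype.ext h)
    simpa [h2] using h1
  let s : Z n → ℝ := fun y => (Real.sqrt (K y y))⁻¹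
  have hs : ∀ y : Z n, s y * s y * K y y = 1 := by
    intro y
    have h1 := Real.mul_self_sqrt (hKpos y).le
    have h2 := (Real.sqrt_pos.2 (hKpos y)).ne'
    simp only [s]
    rw [← mul_inv, h1, inv_mul_cancel₀ (hKpos y).ne']
  let U : Z n → Fin (n + 1) → ℝ := fun y k => s y * p k y
  have hU1 : Matrix.of U * (Matrix.of U).transpose = 1 := by
    ext y y'
    rw [Matrix.mul_apply]
    simp only [Matrix.transpose_apply, Matrix.of_apply]
    have : ∑ k : Fin (n + 1), U y k * U y' k = s y * s y' * K y y' := by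
      simp only [U, hK, Finset.mul_sum]
      rw [← Fin.sum_univ_eq_sum_range (fun k => s y * s y' * (p k y * p k y'))]
      refine Finset.sum_congr rfl fun k _ => ?_
      ring
    rw [this, Matrix.one_apply]
    split_ifs with h
    · subst h; exact hs y
    · rw [hKz y y' h, mul_zero]
  have hU2 : (Matrix.of U).transpose * Matrix.of U = 1 := by
    refine (Matrix.mul_eq_one_comm_of_card_eq _ _ _ (by simp [hZcard])).1 hU1
  let v : Z n → ℝ → ℝ := fun y x => ∑ k : Fin (n + 1), U y k * p k x
  have hvK : ∀ y x, v y x = s y * K x y := by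
    intro y x
    simp only [v, U, hK, Finset.mul_sum]
    rw [← Fin.sum_univ_eq_sum_range (fun k => s y * (p k x * p k y))]
    refine Finset.sum_congr rfl fun k _ => ?_
    ring
  have hvv : ∀ i j x, v i x * v j x
      = ∑ k : Fin (n + 1), ∑ l : Fin (n + 1), U i k * U j l * (p k x * p l x) := by
    intro i j x
    simp only [v]
    rw [Finset.sum_mul_sum]
    refine Finset.sum_congr rfl fun k _ => Finset.sum_congr rfl fun l _ => ?_
    ring
  have hvint : ∀ i j, Integrable (fun x => v i x * v j x) μ := by
    intro i j
    simp only [hvv]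
    exact integrable_finsetSum _ fun k _ => integrable_finsetSum _ fun l _ =>
      (hint (k : ℕ) (l : ℕ)).const_mul _
  have hvort : ∀ i j, ∫ x, v i x * v j x ∂μ = if i = j then 1 else 0 := by
    intro i j
    simp only [hvv]
    have hi2 : ∀ k l : Fin (n + 1), Integrable (fun x => U i k * U j l * (p k x * p l x)) μ :=
      fun k l => (hint k l).const_mul _
    rw [integral_finsetSum _ fun k _ => integrable_finsetSum _ fun l _ =>
      hi2 k l]
    have : ∀ k : Fin (n + 1), ∫ x, ∑ l : Fin (n + 1), U i k * U j l * (p k x * p l x) ∂μ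
        = U i k * U j k := by
      intro k
      rw [integral_finsetSum _ fun l _ => hi2 k l]
      simp only [integral_const_mul, hort, Fin.val_inj]
      simp
    simp only [this]
    have h2 := congrFun (congrFun hU1 i) j
    rw [Matrix.mul_apply, Matrix.one_apply] at h2
    exact h2
  have hsum : ∀ x, ∑ i, v i x * v i x = ∑ k ∈ Finset.range (n + 1), (p k x) ^ 2 := by
    intro x
    simp only [hvv]
    rw [Finset.sum_comm]
    rw [← Fin.sum_univ_eq_sum_range (fun k => (p k x) ^ 2)]
    refine Finset.sum_congr rfl fun k _ => ?_
    rw [Finset.sum_comm]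
    have : ∀ l : Fin (n + 1), ∑ i, U i k * U i l * (p k x * p l x)
        = (if k = l then 1 else 0) * (p k x * p l x) := by
      intro l
      rw [← Finset.sum_mul]
      have h2 := congrFun (congrFun hU2 k) l
      rw [Matrix.mul_apply, Matrix.one_apply] at h2
      rw [← h2]
      rfl
    simp only [this]
    simp [pow_two]
  have key := core_bound μ (fun y : Z n => (y : ℝ)) (fun y => s y * (a n * p n y)) v (p (n + 1))
    ?_ hvint hvort hz
  · rw [cauchy_zero Z n hz, cauchy_cd p hc, norm_sub_rev]
    rw [Finset.sum_sub_distrib, ← integral_finsetSum _ fun i _ =>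
      integrable_mul_resolvent hz (hvint i i)] at key
    refine le_of_eq_of_le ?_ key
    congr 3
    funext x
    rw [← hsum, ← Finset.sum_mul]
    push_cast
    rfl
  · intro y x
    have h1 := hcd x y
    rw [(hZ n y).1 y.2] at h1
    rw [hvK]
    linear_combination s y * h1

lemma shift_bound (p : ℕ → ℝ → ℝ) (hc : ∀ n, Continuous (p n))
    (μ : Measure ℝ) (hμ : Orthonormalizes p μ) (L n : ℕ) (z : ℂ) (hz : z.im ≠ 0) :
    ‖cauchyTransform (cdMeasure p μ (n + L)) z - cauchyTransform (cdMeasure p μ n) z‖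
      ≤ L * |z.im|⁻¹ := by
  obtain ⟨-, hint, hort⟩ := hμ
  have hi : ∀ k, Integrable (fun x => (p k x) ^ 2) μ := fun k => by
    simpa only [pow_two] using hint k k
  have hstep : ∀ m, cauchyTransform (cdMeasure p μ m) z
      = ∑ k ∈ Finset.range (m + 1), ∫ x, (((p k x) ^ 2 : ℝ) : ℂ) * ((x : ℂ) - z)⁻¹ ∂μ := by
    intro m
    rw [cauchy_cd p hc, ← integral_finsetSum _ fun k _ => integrable_mul_resolvent hz (hi k)]
    congr 1
    funext x
    rw [← Finset.sum_mul]
    push_cast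
    rfl
  have hb : ∀ k, ‖∫ x, (((p k x) ^ 2 : ℝ) : ℂ) * ((x : ℂ) - z)⁻¹ ∂μ‖ ≤ |z.im|⁻¹ := by
    intro k
    have h1 : ∫ x, |z.im|⁻¹ * (p k x) ^ 2 ∂μ = |z.im|⁻¹ := by
      have := hort k k
      simp only [if_true, ← pow_two] at this
      rw [integral_const_mul, this, mul_one]
    refine (norm_integral_le_of_norm_le ((hi k).const_mul |z.im|⁻¹)
      (Eventually.of_forall fun x => ?_)).trans_eq h1
    rw [norm_mul, Complex.norm_real, Real.norm_eq_abs, abs_of_nonneg (sq_nonneg _), mul_comm]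
    gcongr
    exact norm_resolvent_le hz x
  induction L with
  | zero => simp
  | succ L ih =>
    have : cauchyTransform (cdMeasure p μ (n + (L + 1))) z
        = cauchyTransform (cdMeasure p μ (n + L)) z
          + ∫ x, (((p (n + L + 1) x) ^ 2 : ℝ) : ℂ) * ((x : ℂ) - z)⁻¹ ∂μ := by
      rw [hstep, hstep, ← add_assoc, Finset.sum_range_succ]
    rw [this, add_sub_right_comm]
    refine (norm_add_le _ _).trans ((add_le_add ih (hb _)).trans_eq ?_)
    push_cast; ring

/-- Theorem C = Theorem 4 of the paper, determinate case. -/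
theorem stmt_5
    (a b : ℕ → ℝ) (ha : ∀ n, 0 < a n)
    (p : ℕ → ℝ → ℝ)
    (hp0 : ∀ x : ℝ, p 0 x = 1)
    (hp1 : ∀ x : ℝ, p 1 x = (x - b 0) / a 0)
    (hprec : ∀ n : ℕ, ∀ x : ℝ,
      a n * p n x + b (n + 1) * p (n + 1) x + a (n + 1) * p (n + 2) x = x * p (n + 1) x)
    (Z : ℕ → Finset ℝ)
    (hZcard : ∀ n, (Z n).card = n + 1)
    (hZ : ∀ n, ∀ y : ℝ, y ∈ Z n ↔ p (n + 1) y = 0)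
    (μ : Measure ℝ) (hμ : Orthonormalizes p μ)
    (hdet : ∀ μ' : Measure ℝ, Orthonormalizes p μ' → μ' = μ)
    (ρ : ℕ → ℝ) (hρpos : ∀ n, 0 < ρ n) (hρ : Tendsto ρ atTop atTop) :
    TendstoLocallyUniformlyOn
      (fun n z => ((ρ n : ℂ))⁻¹ * cauchyTransform (zeroCountingMeasure Z n) z -
        ((ρ n : ℂ))⁻¹ * cauchyTransform (cdMeasure p μ n) z)
      (fun _ => 0) atTop {z : ℂ | z.im ≠ 0} ∧
    ∀ L : ℕ,
      TendstoLocallyUniformlyOn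
        (fun n z => ((ρ n : ℂ))⁻¹ * cauchyTransform (cdMeasure p μ (n + L)) z -
          ((ρ n : ℂ))⁻¹ * cauchyTransform (cdMeasure p μ n) z)
        (fun _ => 0) atTop {z : ℂ | z.im ≠ 0} := by
  have hc := p_continuous a b ha p hp0 hp1 hprec
  refine ⟨?_, fun L => ?_⟩
  · exact tendsto_of_bound ρ hρ (fun n z => cauchyTransform (zeroCountingMeasure Z n) z)
      (fun n z => cauchyTransform (cdMeasure p μ n) z) 2 (by norm_num)
      (main_bound a b ha p hp0 hp1 hprec Z hZcard hZ μ hμ)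
  · exact tendsto_of_bound ρ hρ (fun n z => cauchyTransform (cdMeasure p μ (n + L)) z)
      (fun n z => cauchyTransform (cdMeasure p μ n) z) L (by positivity)
      (shift_bound p hc μ hμ L)
end

section
/- Let a = (a_n)_{n≥0} be a sequence of positive reals, b = (b_n)_{n≥0} a sequence of reals, and let N ≥ 1 and n ≥ 1 be integers. Then every complex zero of the function z ↦ discr X_n(z) = (tr X_n(z))² − 4·a_{n−1}/a_{n+N−1} is real; that is, if z ∈ ℂ and discr X_n(z) = 0, then Im z = 0. -/
open Filter Topology

/-- The one–step transfer matrix `B_j(x)` associated with Jacobi parameters `a, b`. -/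
noncomputable def jacobiB (a b : ℕ → ℝ) (j : ℕ) (x : ℂ) : Matrix (Fin 2) (Fin 2) ℂ :=
  !![0, 1; -((a (j - 1) : ℂ) / (a j : ℂ)), (x - (b j : ℂ)) / (a j : ℂ)]

/-- The `N`-step transfer matrix `X_n(x) = B_{n+N-1}(x) ⋯ B_{n+1}(x) B_n(x)`. -/
noncomputable def transferX (a b : ℕ → ℝ) (N n : ℕ) (x : ℂ) : Matrix (Fin 2) (Fin 2) ℂ :=
  (((List.range N).map (fun k => jacobiB a b (n + k) x)).reverse).prod

theorem transferX_succ (a b : ℕ → ℝ) (N n : ℕ) (x : ℂ) :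
    transferX a b (N + 1) n x = jacobiB a b (n + N) x * transferX a b N n x := by
  simp [transferX, List.range_succ]

theorem transferX_det (a b : ℕ → ℝ) (ha : ∀ n, 0 < a n) (m : ℕ) (x : ℂ) (N : ℕ) :
    (transferX a b N (m + 1) x).det = (a m : ℂ) / (a (m + N) : ℂ) := by
  have hc : ∀ k, (a k : ℂ) ≠ 0 := fun k => by exact_mod_cast (ha k).ne'
  induction N with
  | zero => simp [transferX, hc]
  | succ k ih =>
    rw [transferX_succ, Matrix.det_mul, ih, jacobiB, Matrix.det_fin_two_of]
    have e1 : m + 1 + k - 1 = m + k := by omega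
    have e2 : m + 1 + k = m + (k + 1) := by omega
    rw [e1, e2]
    have h1 := hc (m + k)
    have h2 := hc (m + (k + 1))
    field_simp
    ring

theorem step_zero (a b : ℕ → ℝ) (n N : ℕ) (x : ℂ) (w : Fin 2 → ℂ) :
    (transferX a b (N + 1) n x).mulVec w 0 = (transferX a b N n x).mulVec w 1 := by
  rw [transferX_succ, ← Matrix.mulVec_mulVec]
  simp [jacobiB, Matrix.mulVec, dotProduct, Fin.sum_univ_two]

theorem step_one (a b : ℕ → ℝ) (ha : ∀ n, 0 < a n) (m N : ℕ) (x : ℂ) (w : Fin 2 → ℂ) :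
    (a (m + N + 1) : ℂ) * (transferX a b (N + 1) (m + 1) x).mulVec w 1 =
      (x - b (m + N + 1)) * (transferX a b N (m + 1) x).mulVec w 1
      - a (m + N) * (transferX a b N (m + 1) x).mulVec w 0 := by
  have hc : (a (m + N + 1) : ℂ) ≠ 0 := by exact_mod_cast (ha _).ne'
  rw [transferX_succ, ← Matrix.mulVec_mulVec]
  generalize (transferX a b N (m + 1) x).mulVec w = v
  have e2 : m + 1 + N = m + N + 1 := by omega
  simp only [jacobiB, Matrix.mulVec, dotProduct, Fin.sum_univ_two, e2, Nat.add_sub_cancel]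
  simp
  field_simp
  ring

theorem wronskian (a b : ℕ → ℝ) (ha : ∀ n, 0 < a n) (m : ℕ) (x : ℂ) (w : Fin 2 → ℂ) (N : ℕ) :
    a (m + N) * ((starRingEnd ℂ) ((transferX a b N (m + 1) x).mulVec w 0) *
        (transferX a b N (m + 1) x).mulVec w 1).im =
      a m * ((starRingEnd ℂ) (w 0) * w 1).im +
      x.im * ∑ k ∈ Finset.range N, Complex.normSq ((transferX a b k (m + 1) x).mulVec w 1) := by
  induction N with
  | zero => simp [transferX]
  | succ k ih =>
    rw [Finset.sum_range_succ, mul_add, ← add_assoc m k 1, ← add_assoc (a m * _), ← ih, step_zero]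
    have h := step_one a b ha m k x w
    have hr := congrArg Complex.re h
    have hi := congrArg Complex.im h
    generalize (transferX a b (k + 1) (m + 1) x).mulVec w 1 = p at *
    generalize (transferX a b k (m + 1) x).mulVec w 1 = q at *
    generalize (transferX a b k (m + 1) x).mulVec w 0 = r at *
    simp [Complex.normSq_apply] at hr hi ⊢
    linear_combination q.re * hi - q.im * hr

/-- key claim of Proposition 11 of the paper:
every zero of `discr X_n = (tr X_n)² - 4 a_{n-1}/a_{n+N-1}` is real. -/
theorem stmt_9
    (a b : ℕ → ℝ) (ha : ∀ n, 0 < a n)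
    (N n : ℕ) (hN : 1 ≤ N) (hn : 1 ≤ n)
    (z : ℂ)
    (hz : (Matrix.trace (transferX a b N n z)) ^ 2 -
      4 * ((a (n - 1) : ℂ) / (a (n + N - 1) : ℂ)) = 0) :
    z.im = 0 := by
  obtain ⟨m, rfl⟩ : ∃ m, n = m + 1 := ⟨n - 1, by omega⟩
  obtain ⟨M, rfl⟩ : ∃ M, N = M + 1 := ⟨N - 1, by omega⟩
  have e1 : m + 1 + (M + 1) - 1 = m + (M + 1) := by omega
  rw [e1, Nat.add_sub_cancel] at hz
  have hdet := transferX_det a b ha m z (M + 1)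
  have hW := wronskian a b ha m z
  have hS := step_zero a b (m + 1) M z
  set X := transferX a b (M + 1) (m + 1) z with hX
  obtain ⟨l, hl⟩ : ∃ l : ℂ, l = X.trace / 2 := ⟨_, rfl⟩
  have hl2 : l ^ 2 = (a m : ℂ) / (a (m + (M + 1)) : ℂ) := by
    rw [hl]; linear_combination hz / 4
  have hpos : 0 < a m / a (m + (M + 1)) := div_pos (ha _) (ha _)
  have hl0 : l ≠ 0 := by
    rintro rfl
    have : ((a m / a (m + (M + 1)) : ℝ) : ℂ) = 0 := by
      push_cast; rw [← hl2]; simp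
    exact hpos.ne' (by exact_mod_cast this)
  have hn2 : Complex.normSq l * a (m + (M + 1)) = a m := by
    have h1 : Complex.normSq (l ^ 2) = (a m / a (m + (M + 1))) ^ 2 := by
      rw [hl2, ← Complex.ofReal_div, Complex.normSq_ofReal]; ring
    rw [map_pow] at h1
    have h2 := (pow_left_inj₀ (Complex.normSq_nonneg l) hpos.le two_ne_zero).1 h1
    rw [h2]
    exact div_mul_cancel₀ _ (ha _).ne'
  have hd0 : (X - Matrix.scalar (Fin 2) l).det = 0 := by
    rw [Matrix.det_fin_two] at hdet ⊢
    rw [Matrix.trace_fin_two] at hl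
    simp
    linear_combination hdet - hl2 + 2 * l * hl
  obtain ⟨w, hw0, hw⟩ := Matrix.exists_mulVec_eq_zero_iff.2 hd0
  have hXw : X.mulVec w = l • w := by
    rw [Matrix.sub_mulVec, sub_eq_zero] at hw
    rw [hw]
    ext i
    simp [Matrix.mulVec_diagonal]
  by_contra hzim
  have hWw := hW w (M + 1)
  rw [← hX, hXw] at hWw
  have hsum : ∑ k ∈ Finset.range (M + 1),
      Complex.normSq ((transferX a b k (m + 1) z).mulVec w 1) = 0 := by
    have h3 : ((starRingEnd ℂ) ((l • w) 0) * (l • w) 1).im =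
        Complex.normSq l * ((starRingEnd ℂ) (w 0) * w 1).im := by
      simp [Complex.normSq_apply]; ring
    rw [h3] at hWw
    refine (mul_eq_zero.1 ?_).resolve_left hzim
    linear_combination -hWw + ((starRingEnd ℂ) (w 0) * w 1).im * hn2
  rw [Finset.sum_eq_zero_iff_of_nonneg (fun _ _ => Complex.normSq_nonneg _)] at hsum
  have h1 : w 1 = 0 := by
    have := hsum 0 (by simp)
    simpa [transferX] using this
  have h0 : w 0 = 0 := by
    have h4 := Complex.normSq_eq_zero.1 (hsum M (by simp))
    have h5 := hS w
    rw [h4, hXw] at h5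
    simpa [hl0] using h5
  apply hw0
  ext i
  fin_cases i <;> simp [h0, h1]
end

section
/- Fix Jacobi parameters (a_n), (b_n), an integer N ≥ 1, and let (p_n) and (ν_n) be the associated orthonormal polynomials and zero counting measures. Let U ⊆ ℂ∖ℝ be open, M ≥ 1, and let (λ_j)_{j≥M} be holomorphic functions λ_j : U → ℂ∖{0}. Suppose that for some i₀ ∈ {0, 1, …, N−1}, p_{kN+i₀}(z)/Π_{j=M}^{k−1} λ_j(z) → φ(z) as k → ∞, locally uniformly on U, where φ : U → ℂ has no zeros in U. Then for every sequence (ρ_n)_{n≥1} of positive reals tending to infinity, C[(1/ρ_{kN+i₀−1})·ν_{kN+i₀−1}](z) + (1/ρ_{kN+i₀−1})·Σ_{j=M}^{k−1} λ_j'(z)/λ_j(z) → 0 as k → ∞, locally uniformly in z ∈ U. -/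
open MeasureTheory Filter Topology

lemma aux_poly (a b : ℕ → ℝ) (ha : ∀ n, 0 < a n) (p : ℕ → ℂ → ℂ)
    (hp0 : ∀ x : ℂ, p 0 x = 1)
    (hp1 : ∀ x : ℂ, p 1 x = (x - (b 0 : ℂ)) / (a 0 : ℂ))
    (hprec : ∀ n : ℕ, ∀ x : ℂ,
      (a n : ℂ) * p n x + (b (n + 1) : ℂ) * p (n + 1) x + (a (n + 1) : ℂ) * p (n + 2) x =
        x * p (n + 1) x) (n : ℕ) :
    ∃ P : Polynomial ℂ, P.natDegree ≤ n ∧ ∀ x, P.eval x = p n x := by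
  induction n using Nat.strong_induction_on with
  | _ n ih =>
    match n with
    | 0 => exact ⟨1, by simp, by simp [hp0]⟩
    | 1 =>
      refine ⟨Polynomial.C ((a 0 : ℂ)⁻¹) * (Polynomial.X - Polynomial.C (b 0 : ℂ)), ?_, ?_⟩
      · refine (Polynomial.natDegree_C_mul_le _ _).trans ?_
        simp
      · intro x
        simp [hp1]
        ring
    | (n+2) =>
      obtain ⟨P, hP, hPe⟩ := ih n (by omega)
      obtain ⟨Q, hQ, hQe⟩ := ih (n+1) (by omega)
      refine ⟨Polynomial.C ((a (n+1) : ℂ)⁻¹) *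
        ((Polynomial.X - Polynomial.C (b (n+1) : ℂ)) * Q - Polynomial.C (a n : ℂ) * P), ?_, ?_⟩
      · refine (Polynomial.natDegree_C_mul_le _ _).trans ?_
        refine (Polynomial.natDegree_sub_le _ _).trans ?_
        refine max_le ?_ ?_
        · refine Polynomial.natDegree_mul_le.trans ?_
          rw [Polynomial.natDegree_X_sub_C]
          omega
        · exact (Polynomial.natDegree_C_mul_le _ _).trans (by omega)
      · intro x
        have h0 : (a (n+1) : ℂ) ≠ 0 := by exact_mod_cast (ha (n+1)).ne'
        have := hprec n x
        simp only [Polynomial.eval_mul, Polynomial.eval_C, Polynomial.eval_sub, Polynomial.eval_X,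
          hPe, hQe]
        rw [inv_mul_eq_iff_eq_mul₀ h0]
        linear_combination -this

lemma aux_factor (P : Polynomial ℂ) (n : ℕ) (hP : P.natDegree ≤ n + 1) (Z : Finset ℝ)
    (hZc : Z.card = n + 1) (hZ : ∀ y : ℝ, y ∈ Z ↔ P.eval (y : ℂ) = 0) :
    ∃ c : ℂ, c ≠ 0 ∧ ∀ z, P.eval z = c * ∏ y ∈ Z, (z - (y : ℂ)) := by
  have hne : P ≠ 0 := by
    rintro rfl
    obtain ⟨y, hy⟩ := Infinite.exists_notMem_finset Z
    exact hy ((hZ y).2 (by simp))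
  let S : Finset ℂ := Z.map ⟨((↑) : ℝ → ℂ), Complex.ofReal_injective⟩
  have hS : S.card = n + 1 := by simp [S, hZc]
  have hr : P.roots = S.val := by
    refine Polynomial.roots_eq_of_natDegree_le_card_of_ne_zero ?_ (by rw [hS]; exact hP) hne
    intro x hx
    simp only [S, Finset.mem_map, Function.Embedding.coeFn_mk] at hx
    obtain ⟨y, hy, rfl⟩ := hx
    exact (hZ y).1 hy
  have hcard : Multiset.card P.roots = P.natDegree := by
    refine le_antisymm (Polynomial.card_roots' P) ?_
    rw [hr]
    exact hP.trans hS.ge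
  refine ⟨P.leadingCoeff, by simpa using hne, fun z => ?_⟩
  have h := Polynomial.C_leadingCoeff_mul_prod_multiset_X_sub_C hcard
  rw [hr] at h
  have h2 : (Multiset.map (fun a => Polynomial.X - Polynomial.C a) S.val).prod
      = ∏ y ∈ Z, (Polynomial.X - Polynomial.C (y : ℂ)) := by
    change ∏ y ∈ S, (Polynomial.X - Polynomial.C y) = _
    simp [S]
  rw [h2] at h
  conv_lhs => rw [← h]
  simp [Polynomial.eval_prod]

lemma aux_cauchy (Z : ℕ → Finset ℝ) (n : ℕ) (z : ℂ) :
    cauchyTransform (zeroCountingMeasure Z n) z = ∑ y ∈ Z n, ((y : ℂ) - z)⁻¹ := by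
  unfold cauchyTransform zeroCountingMeasure
  rw [integral_finsetSum_measure]
  · simp [integral_dirac]
  · intro i _
    exact integrable_dirac (by simp)

/-- Proposition 8 of the paper. -/
theorem stmt_15
    (a b : ℕ → ℝ) (ha : ∀ n, 0 < a n)
    (N : ℕ) (hN : 1 ≤ N)
    (p : ℕ → ℂ → ℂ)
    (hp0 : ∀ x : ℂ, p 0 x = 1)
    (hp1 : ∀ x : ℂ, p 1 x = (x - (b 0 : ℂ)) / (a 0 : ℂ))
    (hprec : ∀ n : ℕ, ∀ x : ℂ,
      (a n : ℂ) * p n x + (b (n + 1) : ℂ) * p (n + 1) x + (a (n + 1) : ℂ) * p (n + 2) x =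
        x * p (n + 1) x)
    (Z : ℕ → Finset ℝ)
    (hZcard : ∀ n, (Z n).card = n + 1)
    (hZ : ∀ n, ∀ y : ℝ, y ∈ Z n ↔ p (n + 1) (y : ℂ) = 0)
    (U : Set ℂ) (hUopen : IsOpen U) (hU : U ⊆ {z : ℂ | z.im ≠ 0})
    (M : ℕ) (hM : 1 ≤ M)
    (lam : ℕ → ℂ → ℂ)
    (hlamhol : ∀ j ≥ M, DifferentiableOn ℂ (lam j) U)
    (hlamne : ∀ j ≥ M, ∀ z ∈ U, lam j z ≠ 0)
    (i₀ : ℕ) (hi₀ : i₀ < N)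
    (φ : ℂ → ℂ) (hφne : ∀ z ∈ U, φ z ≠ 0)
    (hconv : TendstoLocallyUniformlyOn
      (fun k z => p (k * N + i₀) z / ∏ j ∈ Finset.Ico M k, lam j z) φ atTop U)
    (ρ : ℕ → ℝ) (hρpos : ∀ n, 0 < ρ n) (hρ : Tendsto ρ atTop atTop) :
    TendstoLocallyUniformlyOn
      (fun k z =>
        ((ρ (k * N + i₀ - 1) : ℂ))⁻¹ *
            cauchyTransform (zeroCountingMeasure Z (k * N + i₀ - 1)) z +
          ((ρ (k * N + i₀ - 1) : ℂ))⁻¹ *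
            ∑ j ∈ Finset.Ico M k, deriv (lam j) z / lam j z)
      (fun _ => 0) atTop U := by
  have hpoly := aux_poly a b ha p hp0 hp1 hprec
  have hfac : ∀ n, ∃ c : ℂ, c ≠ 0 ∧ ∀ z, p (n+1) z = c * ∏ y ∈ Z n, (z - (y : ℂ)) := by
    intro n
    obtain ⟨P, hP, hPe⟩ := hpoly (n+1)
    obtain ⟨c, hc, h⟩ := aux_factor P n hP (Z n) (hZcard n) (fun y => by rw [hZ, hPe])
    exact ⟨c, hc, fun z => by rw [← hPe, h]⟩
  have hpd : ∀ n, Differentiable ℂ (p n) := by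
    intro n
    obtain ⟨P, _, hPe⟩ := hpoly n
    have : p n = fun x => P.eval x := by ext x; rw [hPe]
    rw [this]
    exact P.differentiable
  have hΛne : ∀ k, ∀ z ∈ U, ∏ j ∈ Finset.Ico M k, lam j z ≠ 0 := fun k z hz =>
    Finset.prod_ne_zero_iff.2 fun j hj => hlamne j (Finset.mem_Ico.1 hj).1 z hz
  have hΛd : ∀ k, DifferentiableOn ℂ (fun z => ∏ j ∈ Finset.Ico M k, lam j z) U := fun k =>
    DifferentiableOn.fun_finsetProd fun j hj => hlamhol j (Finset.mem_Ico.1 hj).1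
  have hFd : ∀ k, DifferentiableOn ℂ
      (fun z => p (k * N + i₀) z / ∏ j ∈ Finset.Ico M k, lam j z) U := fun k =>
    ((hpd _).differentiableOn).fun_div (hΛd k) (hΛne k)
  have hφd : DifferentiableOn ℂ φ U := hconv.differentiableOn (Eventually.of_forall hFd) hUopen
  have hderiv := hconv.deriv (Eventually.of_forall hFd) hUopen
  have hρ' : Tendsto (fun k : ℕ => ((ρ (k * N + i₀ - 1) : ℂ))⁻¹) atTop (𝓝 0) := by
    have h1 : Tendsto (fun k : ℕ => k * N + i₀ - 1) atTop atTop := by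
      refine tendsto_atTop_mono (f := fun k : ℕ => k - 1) (fun k => ?_) (tendsto_sub_atTop_nat 1)
      have : k ≤ k * N := Nat.le_mul_of_pos_right k hN
      omega
    have h2 : Tendsto (fun k : ℕ => (ρ (k * N + i₀ - 1))⁻¹) atTop (𝓝 0) :=
      tendsto_inv_atTop_zero.comp (hρ.comp h1)
    have h3 := (Complex.continuous_ofReal.tendsto 0).comp h2
    simpa [Function.comp_def] using h3
  rw [tendstoLocallyUniformlyOn_iff_filter]
  intro x hx
  rw [← tendsto_prod_filter_iff]
  have hfst : Tendsto (Prod.fst : ℕ × ℂ → ℕ) (atTop ×ˢ 𝓝[U] x) atTop := tendsto_fst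
  have hsnd : Tendsto (Prod.snd : ℕ × ℂ → ℂ) (atTop ×ˢ 𝓝[U] x) (𝓝[U] x) := tendsto_snd
  have key : ∀ (F : ℕ → ℂ → ℂ) (f : ℂ → ℂ), TendstoLocallyUniformlyOn F f atTop U →
      ContinuousOn f U →
      Tendsto (fun q : ℕ × ℂ => F q.1 q.2) (atTop ×ˢ 𝓝[U] x) (𝓝 (f x)) := by
    intro F f hF hf
    refine tendsto_comp_of_locally_uniform_limit_within (F := fun q : ℕ × ℂ => F q.1)
      (hf x hx) hsnd ?_
    intro u hu
    obtain ⟨t, ht, h⟩ := hF u hu x hx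
    exact ⟨t, ht, hfst.eventually h⟩
  have hA := key _ _ hconv hφd.continuousOn
  have hB := key _ _ hderiv (hφd.deriv hUopen).continuousOn
  have hC := ((hρ'.comp hfst).mul (hB.div hA (hφne x hx))).neg
  simp only [zero_mul, neg_zero] at hC
  refine hC.congr' ?_
  have hU' : ∀ᶠ q : ℕ × ℂ in atTop ×ˢ 𝓝[U] x, q.2 ∈ U := hsnd.eventually self_mem_nhdsWithin
  filter_upwards [hU', hfst.eventually (eventually_ge_atTop 1)] with q hq hk
  obtain ⟨k, z⟩ := q
  simp only at hq hk
  simp only [Function.comp_apply, Function.HasUncurry.uncurry, id_eq]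
  obtain ⟨n, hn⟩ : ∃ n, k * N + i₀ = n + 1 := by
    have : k ≤ k * N := Nat.le_mul_of_pos_right k hN
    exact ⟨k * N + i₀ - 1, by omega⟩
  rw [hn, Nat.add_sub_cancel, aux_cauchy]
  obtain ⟨c, hc, hcp⟩ := hfac n
  have hzy : ∀ y ∈ Z n, z - (y : ℂ) ≠ 0 := by
    intro y _ h
    apply hU hq
    rw [sub_eq_zero.1 h]
    simp
  have hpne : p (n+1) z ≠ 0 := by
    rw [hcp]
    exact mul_ne_zero hc (Finset.prod_ne_zero_iff.2 hzy)
  have hlp : logDeriv (p (n+1)) z = ∑ y ∈ Z n, (z - (y : ℂ))⁻¹ := by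
    have : p (n+1) = fun z => c * ∏ y ∈ Z n, (z - (y : ℂ)) := funext hcp
    rw [this, logDeriv_const_mul z c hc, logDeriv_prod hzy (fun y _ => by fun_prop)]
    refine Finset.sum_congr rfl fun y _ => ?_
    simp [logDeriv_apply]
  have hld : logDeriv (fun z => p (n+1) z / ∏ j ∈ Finset.Ico M k, lam j z) z =
      ∑ y ∈ Z n, (z - (y : ℂ))⁻¹ - ∑ j ∈ Finset.Ico M k, deriv (lam j) z / lam j z := by
    rw [logDeriv_div z hpne (hΛne k z hq) (hpd _ z) ((hΛd k).differentiableAt (hUopen.mem_nhds hq)),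
      hlp, logDeriv_prod (fun j hj => hlamne j (Finset.mem_Ico.1 hj).1 z hq)
      (fun j hj => (hlamhol j (Finset.mem_Ico.1 hj).1).differentiableAt (hUopen.mem_nhds hq))]
    rfl
  have hneg : ∑ y ∈ Z n, ((y : ℂ) - z)⁻¹ = - ∑ y ∈ Z n, (z - (y : ℂ))⁻¹ := by
    rw [← Finset.sum_neg_distrib]
    refine Finset.sum_congr rfl fun y _ => ?_
    rw [← inv_neg, neg_sub]
  rw [logDeriv_apply] at hld
  simp only [Pi.div_apply, hn]
  rw [hld, hneg]
  ring
end
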